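/- Let (c,u) be a travelling-wave solution of the one-species free-boundary problem such that u is globally Lipschitz, ∂ₓu < 0 on Ω = {u > 0}, and the free boundary is Γ = {(φ(y), y) : y < 0} with φ real-analytic and locally Lipschitz and with (0,0) in the closure of Γ. Then for every y₀ < 0, the function φ is (globally) Lipschitz continuous on the half-line (-∞, y₀]. -/

import Mathlib

open Real Filter Topology Set Asymptotics

noncomputable section

/-- Partial derivative in the first (horizontal) variable. -/
def pdx (u : ℝ → ℝ → ℝ) (x y : ℝ) : ℝ := deriv (fun t => u t y) x

/-- Partial derivative in the second (vertical) variable. -/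
def pdy (u : ℝ → ℝ → ℝ) (x y : ℝ) : ℝ := deriv (fun t => u x t) y

/-- Second partial derivative in the first variable. -/
def pdxx (u : ℝ → ℝ → ℝ) (x y : ℝ) : ℝ := deriv (fun t => pdx u t y) x

/-- Second partial derivative in the second variable. -/
def pdyy (u : ℝ → ℝ → ℝ) (x y : ℝ) : ℝ := deriv (fun t => pdy u x t) y

/-- The closed lower half-plane `H = {(x,y) : y ≤ 0}`. -/
def lowerH : Set (ℝ × ℝ) := {p | p.2 ≤ 0}

/-- The positivity set `Ω = {u > 0}` inside the closed lower half-plane. -/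
def posSet (u : ℝ → ℝ → ℝ) : Set (ℝ × ℝ) := {p | p.2 ≤ 0 ∧ 0 < u p.1 p.2}

/-- The free boundary `Γ = ∂Ω ∩ {y < 0}`. -/
def freeBdry (u : ℝ → ℝ → ℝ) : Set (ℝ × ℝ) :=
  frontier (posSet u) ∩ {p | p.2 < 0}

/-- A travelling-wave solution of the one-species free-boundary problem in the
lower half-plane, with diffusivities `d` (field), `D` (road), exchange parameter `μ`
and speed `c`. -/
structure OneSpeciesTW (d D μ c : ℝ) (u : ℝ → ℝ → ℝ) : Prop where
  c_pos : 0 < c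
  cont : ContinuousOn (fun p : ℝ × ℝ => u p.1 p.2) lowerH
  mem01 : ∀ x y : ℝ, y ≤ 0 → u x y ∈ Icc (0:ℝ) 1
  relOpen : ∃ V : Set (ℝ × ℝ), IsOpen V ∧ posSet u = V ∩ lowerH
  smooth : ContDiffOn ℝ 2 (fun p : ℝ × ℝ => u p.1 p.2) (posSet u ∩ {p | p.2 < 0})
  pde : ∀ p ∈ posSet u ∩ {p : ℝ × ℝ | p.2 < 0},
      -d * (pdxx u p.1 p.2 + pdyy u p.1 p.2) + c * pdx u p.1 p.2 = 0
  grad_ext : ∃ G₁ G₂ : ℝ × ℝ → ℝ,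
      ContinuousOn G₁ (posSet u ∪ freeBdry u) ∧
      ContinuousOn G₂ (posSet u ∪ freeBdry u) ∧
      (∀ p ∈ posSet u ∩ {p : ℝ × ℝ | p.2 < 0},
        G₁ p = pdx u p.1 p.2 ∧ G₂ p = pdy u p.1 p.2) ∧
      (∀ p ∈ freeBdry u, (G₁ p) ^ 2 + (G₂ p) ^ 2 = 1)
  road_diffx : ∀ x : ℝ, 0 < u x 0 → DifferentiableAt ℝ (fun t => u t 0) x
  road_diffxx : ∀ x : ℝ, 0 < u x 0 → DifferentiableAt ℝ (fun t => pdx u t 0) x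
  road_diffy : ∀ x : ℝ, 0 < u x 0 → DifferentiableAt ℝ (fun t => u x t) 0
  road : ∀ x : ℝ, 0 < u x 0 →
      -D * pdxx u x 0 + c * pdx u x 0 + (1/μ) * pdy u x 0 = 0
  lim_left : ∀ ε > 0, ∃ M : ℝ, ∀ x ≤ M, ∀ y ≤ (0:ℝ), |u x y - 1| < ε
  lim_right : ∀ y ≤ (0:ℝ), Tendsto (fun x => u x y) atTop (𝓝 0)


/-- slicewise value of the operator `f_xx + f_yy - k f_x` -/
def HasL (k : ℝ) (f : ℝ → ℝ → ℝ) (x y l : ℝ) : Prop :=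
  ∃ fx fy : ℝ → ℝ, ∃ fxx fyy : ℝ,
    (∀ᶠ t in 𝓝 x, HasDerivAt (fun s => f s y) (fx t) t) ∧ HasDerivAt fx fxx x ∧
    (∀ᶠ t in 𝓝 y, HasDerivAt (fun s => f x s) (fy t) t) ∧ HasDerivAt fy fyy y ∧
    l = fxx + fyy - k * fx x

theorem second_test {f f' : ℝ → ℝ} {x f'' : ℝ} (h1 : ∀ᶠ t in 𝓝 x, HasDerivAt f (f' t) t)
    (h2 : HasDerivAt f' f'' x) (hm : IsLocalMin f x) : f' x = 0 ∧ 0 ≤ f'' := by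
  have hx := h1.self_of_nhds
  have h0 : f' x = 0 := hm.hasDerivAt_eq_zero hx
  refine ⟨h0, ?_⟩
  by_contra hneg
  push Not at hneg
  have hd : deriv f =ᶠ[𝓝 x] f' := h1.mono fun t ht => ht.deriv
  have hdd : deriv (deriv f) x = f'' := by
    rw [hd.deriv_eq]; exact h2.deriv
  have hM : IsLocalMax f x := by
    apply isLocalMax_of_deriv_deriv_neg (by rw [hdd]; exact hneg)
    · rw [hx.deriv, h0]
    · exact hx.continuousAt
  have hc : f =ᶠ[𝓝 x] fun _ => f x := by
    filter_upwards [hm, hM] with t a b using le_antisymm b a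
  have hc2 : deriv f =ᶠ[𝓝 x] fun _ => 0 := by
    have := hc.deriv
    simpa using this
  have : deriv (deriv f) x = 0 := by rw [hc2.deriv_eq]; simp
  linarith

theorem HasL.min_test {k : ℝ} {f : ℝ → ℝ → ℝ} {x y l : ℝ} (h : HasL k f x y l)
    (hm : IsLocalMin (fun p : ℝ × ℝ => f p.1 p.2) (x, y)) : 0 ≤ l := by
  obtain ⟨fx, fy, fxx, fyy, h1, h2, h3, h4, rfl⟩ := h
  have c1 : Tendsto (fun s : ℝ => (s, y)) (𝓝 x) (𝓝 (x, y)) :=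
    (Continuous.prodMk_left y).tendsto x
  have c2 : Tendsto (fun s : ℝ => (x, s)) (𝓝 y) (𝓝 (x, y)) :=
    (Continuous.prodMk_right x).tendsto y
  have m1 : IsLocalMin (fun s => f s y) x := c1.eventually hm
  have m2 : IsLocalMin (fun s => f x s) y := c2.eventually hm
  obtain ⟨a, b⟩ := second_test h1 h2 m1
  obtain ⟨_, d⟩ := second_test h3 h4 m2
  rw [a]; linarith

theorem HasL.add {k : ℝ} {f g : ℝ → ℝ → ℝ} {x y l m : ℝ} (h : HasL k f x y l)
    (h' : HasL k g x y m) : HasL k (fun x y => f x y + g x y) x y (l + m) := by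
  obtain ⟨fx, fy, fxx, fyy, h1, h2, h3, h4, rfl⟩ := h
  obtain ⟨gx, gy, gxx, gyy, g1, g2, g3, g4, rfl⟩ := h'
  refine ⟨fun t => fx t + gx t, fun t => fy t + gy t, fxx + gxx, fyy + gyy, ?_, h2.add g2, ?_,
    h4.add g4, by ring⟩
  · filter_upwards [h1, g1] with t a b using a.add b
  · filter_upwards [h3, g3] with t a b using a.add b

theorem HasL.const_mul {k : ℝ} {f : ℝ → ℝ → ℝ} {x y l : ℝ} (c : ℝ) (h : HasL k f x y l) :
    HasL k (fun x y => c * f x y) x y (c * l) := by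
  obtain ⟨fx, fy, fxx, fyy, h1, h2, h3, h4, rfl⟩ := h
  refine ⟨fun t => c * fx t, fun t => c * fy t, c * fxx, c * fyy, ?_, h2.const_mul c, ?_,
    h4.const_mul c, by ring⟩
  · filter_upwards [h1] with t a using a.const_mul c
  · filter_upwards [h3] with t a using a.const_mul c

theorem HasL.shift {k : ℝ} {f : ℝ → ℝ → ℝ} {x y l : ℝ} (a b : ℝ) (h : HasL k f (x + a) (y + b) l) :
    HasL k (fun x y => f (x + a) (y + b)) x y l := by
  obtain ⟨fx, fy, fxx, fyy, h1, h2, h3, h4, rfl⟩ := h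
  refine ⟨fun t => fx (t + a), fun t => fy (t + b), fxx, fyy, ?_, h2.comp_add_const x a, ?_,
    h4.comp_add_const y b, by ring⟩
  · have : Tendsto (fun t : ℝ => t + a) (𝓝 x) (𝓝 (x + a)) := (continuous_add_const a).tendsto x
    filter_upwards [this.eventually h1] with t ht using ht.comp_add_const t a
  · have : Tendsto (fun t : ℝ => t + b) (𝓝 y) (𝓝 (y + b)) := (continuous_add_const b).tendsto y
    filter_upwards [this.eventually h3] with t ht using ht.comp_add_const t b

theorem HasL.reflect {k : ℝ} {f : ℝ → ℝ → ℝ} {x y l : ℝ} (b : ℝ) (h : HasL k f x (b - y) l) :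
    HasL k (fun x y => f x (b - y)) x y l := by
  obtain ⟨fx, fy, fxx, fyy, h1, h2, h3, h4, rfl⟩ := h
  refine ⟨fun t => fx t, fun t => - fy (b - t), fxx, fyy, h1, h2, ?_, ?_, by ring⟩
  · have : Tendsto (fun t : ℝ => b - t) (𝓝 y) (𝓝 (b - y)) := (continuous_sub_left b).tendsto y
    filter_upwards [this.eventually h3] with t ht using ht.comp_const_sub b t
  · have := (h4.comp_const_sub b y).neg
    rw [neg_neg] at this
    exact this

theorem HasL.congr_l {k : ℝ} {f : ℝ → ℝ → ℝ} {x y l m : ℝ} (h : HasL k f x y l) (e : l = m) :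
    HasL k f x y m := e ▸ h

/-- a function with everywhere defined slice derivatives -/
theorem HasL.of_all {k : ℝ} {f : ℝ → ℝ → ℝ} {x y : ℝ} (fx fy : ℝ → ℝ) (fxx fyy : ℝ)
    (h1 : ∀ t, HasDerivAt (fun s => f s y) (fx t) t) (h2 : HasDerivAt fx fxx x)
    (h3 : ∀ t, HasDerivAt (fun s => f x s) (fy t) t) (h4 : HasDerivAt fy fyy y) :
    HasL k f x y (fxx + fyy - k * fx x) :=
  ⟨fx, fy, fxx, fyy, .of_forall h1, h2, .of_forall h3, h4, rfl⟩

theorem deriv_nonneg_of_right {f : ℝ → ℝ} {f' r : ℝ} (hr : 0 < r) (h : HasDerivAt f f' 0)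
    (h0 : f 0 = 0) (hp : ∀ s, 0 < s → s < r → 0 ≤ f s) : 0 ≤ f' := by
  have h1 := h.tendsto_slope_zero_right
  apply ge_of_tendsto h1
  filter_upwards [Ioo_mem_nhdsGT hr] with t ht
  simp only [zero_add, h0, sub_zero, smul_eq_mul]
  exact mul_nonneg (inv_nonneg.2 ht.1.le) (hp t ht.1 ht.2)

/-- the derived facts used in the proof -/
structure Cfg (k : ℝ) (K : ℝ) (u : ℝ → ℝ → ℝ) (φ : ℝ → ℝ) (G₁ G₂ : ℝ × ℝ → ℝ) : Prop where
  kpos : 0 < k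
  om : ∀ x y, y < 0 → (0 < u x y ↔ x < φ y)
  u0 : ∀ x y, y < 0 → 0 ≤ u x y
  u1 : ∀ x y, y < 0 → u x y ≤ 1
  fd : ∀ x y, y < 0 → x < φ y → HasFDerivAt (fun p : ℝ × ℝ => u p.1 p.2)
    (G₁ (x, y) • ContinuousLinearMap.fst ℝ ℝ ℝ + G₂ (x, y) • ContinuousLinearMap.snd ℝ ℝ ℝ) (x, y)
  hasL : ∀ x y, y < 0 → x < φ y → HasL k u x y 0
  ucont : ContinuousOn (fun p : ℝ × ℝ => u p.1 p.2) {p | p.2 < 0}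
  c1 : ContinuousOn G₁ {p | p.2 < 0 ∧ p.1 ≤ φ p.2}
  c2 : ContinuousOn G₂ {p | p.2 < 0 ∧ p.1 ≤ φ p.2}
  gneg : ∀ x y, y < 0 → x < φ y → G₁ (x, y) < 0
  gG : ∀ y, y < 0 → G₁ (φ y, y) ^ 2 + G₂ (φ y, y) ^ 2 = 1
  bnd : ∀ x y, y < 0 → x < φ y → |G₂ (x, y)| ≤ K
  left : ∀ ε > 0, ∃ M : ℝ, ∀ x ≤ M, ∀ y < (0:ℝ), |u x y - 1| < ε
  ana : AnalyticOnNhd ℝ φ (Iio 0)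

theorem pos_iff {d D μ c : ℝ} {u : ℝ → ℝ → ℝ} (hu : OneSpeciesTW d D μ c u)
    (hmono : ∀ p ∈ posSet u, pdx u p.1 p.2 < 0) {φ : ℝ → ℝ}
    (hΓ : freeBdry u = {p : ℝ × ℝ | ∃ y < (0:ℝ), p = (φ y, y)})
    (hop : IsOpen (posSet u ∩ {p : ℝ × ℝ | p.2 < 0})) (x y : ℝ) (hy : y < 0) :
    0 < u x y ↔ x < φ y := by
  have hucont : Continuous fun t => u t y := by
    have : ContinuousOn (fun p : ℝ × ℝ => u p.1 p.2) lowerH := hu.cont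
    exact this.comp_continuous (f := fun t : ℝ => (t, y)) (by fun_prop) (fun t => by
      simp only [lowerH, mem_ofPred_eq]; exact hy.le)
  -- down closed
  have down : ∀ x0 x1, x0 ≤ x1 → 0 < u x1 y → 0 < u x0 y := by
    intro x0 x1 h01 h1
    by_contra hneg
    have hz0 : u x0 y = 0 := le_antisymm (not_lt.1 hneg) (hu.mem01 x0 y hy.le).1
    let A : Set ℝ := {t | t ∈ Icc x0 x1 ∧ u t y = 0}
    have hAc : IsCompact A := by
      have : A = Icc x0 x1 ∩ (fun t => u t y) ⁻¹' {0} := by ext; simp [A]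
      rw [this]
      exact isCompact_Icc.inter_right (isClosed_singleton.preimage hucont)
    obtain ⟨z, hz, hzmax⟩ := hAc.exists_isGreatest ⟨x0, ⟨le_refl _, h01⟩, hz0⟩
    have hzlt : z < x1 := lt_of_le_of_ne hz.1.2 (fun h => by
      have := hz.2; rw [h] at this; linarith)
    have hpos : ∀ t, z < t → t ≤ x1 → 0 < u t y := by
      intro t ht ht1
      rcases (hu.mem01 t y hy.le).1.lt_or_eq with h | h
      · exact h
      · have := hzmax (⟨⟨hz.1.1.trans ht.le, ht1⟩, h.symm⟩ : t ∈ A); linarith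
    have : StrictAntiOn (fun t => u t y) (Icc z x1) := by
      apply strictAntiOn_of_deriv_neg (convex_Icc _ _) hucont.continuousOn
      intro t ht
      rw [interior_Icc] at ht
      exact hmono (t, y) ⟨hy.le, hpos t ht.1 ht.2.le⟩
    have := this ⟨le_refl _, hzlt.le⟩ ⟨hzlt.le, le_refl _⟩ hzlt
    simp only at this
    linarith [hz.2]
  have hfb : (φ y, y) ∈ freeBdry u := by rw [hΓ]; exact ⟨y, hy, rfl⟩
  have hbd : ∀ z, (z, y) ∈ frontier (posSet u) → u z y = 0 := by
    intro z hz
    by_contra hne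
    have hzpos : 0 < u z y := lt_of_le_of_ne (hu.mem01 z y hy.le).1 (Ne.symm hne)
    have : (z, y) ∈ interior (posSet u) := by
      apply mem_interior.2
      exact ⟨_, inter_subset_left, hop, ⟨hy.le, hzpos⟩, hy⟩
    exact hz.2 this
  have h0 : u (φ y) y = 0 := hbd _ hfb.1
  constructor
  · intro h
    by_contra hx
    have := down _ _ (not_lt.1 hx) h
    linarith
  · intro h
    by_contra hneg
    have hz0 : u x y = 0 := le_antisymm (not_lt.1 hneg) (hu.mem01 x y hy.le).1
    obtain ⟨M, hM⟩ := hu.lim_left (1/2) (by norm_num)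
    have hMx : M < x := by
      by_contra hh
      have := hM x (not_lt.1 hh) y hy.le
      rw [hz0] at this; norm_num at this
    let A : Set ℝ := {t | t ∈ Icc M x ∧ u t y = 0}
    have hAc : IsCompact A := by
      have : A = Icc M x ∩ (fun t => u t y) ⁻¹' {0} := by ext; simp [A]
      rw [this]
      exact isCompact_Icc.inter_right (isClosed_singleton.preimage hucont)
    obtain ⟨z, hz, hzmin⟩ := hAc.exists_isLeast ⟨x, ⟨hMx.le, le_refl _⟩, hz0⟩
    have hMz : M < z := lt_of_le_of_ne hz.1.1 (fun h => by
      have := hM M le_rfl y hy.le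
      rw [h, hz.2] at this; norm_num at this)
    have hpos : ∀ t, M < t → t < z → 0 < u t y := by
      intro t ht ht1
      rcases (hu.mem01 t y hy.le).1.lt_or_eq with h | h
      · exact h
      · have := hzmin (⟨⟨ht.le, ht1.le.trans hz.1.2⟩, h.symm⟩ : t ∈ A); linarith
    have hfr : (z, y) ∈ freeBdry u := by
      refine ⟨⟨?_, fun hi => ?_⟩, hy⟩
      · have hc : z ∈ closure (Ioo M z) := by
          rw [closure_Ioo hMz.ne]; exact ⟨hMz.le, le_refl _⟩
        have := mem_closure_image (f := fun t : ℝ => (t, y)) (x := z) (by fun_prop) hc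
        refine closure_mono ?_ this
        rintro _ ⟨t, ht, rfl⟩
        exact ⟨hy.le, hpos t ht.1 ht.2⟩
      · have := (interior_subset hi).2
        simp only at this
        linarith [hz.2]
    rw [hΓ] at hfr
    obtain ⟨y', _, he⟩ := hfr
    simp only [Prod.mk.injEq] at he
    obtain ⟨he1, he2⟩ := he
    subst he2
    linarith [hz.1.2]

theorem mk_hasL {k : ℝ} {u : ℝ → ℝ → ℝ} {O : Set (ℝ × ℝ)} (hO : IsOpen O)
    (hs : ContDiffOn ℝ 2 (fun p : ℝ × ℝ => u p.1 p.2) O) {x y : ℝ} (hp : (x, y) ∈ O) :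
    HasL k u x y (pdxx u x y + pdyy u x y - k * pdx u x y) ∧
    HasFDerivAt (fun p : ℝ × ℝ => u p.1 p.2)
    (pdx u x y • ContinuousLinearMap.fst ℝ ℝ ℝ + pdy u x y • ContinuousLinearMap.snd ℝ ℝ ℝ) (x, y) := by
  set f : ℝ × ℝ → ℝ := fun p => u p.1 p.2 with hf
  have hd : ∀ p ∈ O, HasFDerivAt f (fderiv ℝ f p) p := fun p hp =>
    ((hs.differentiableOn (by norm_num)).differentiableAt (hO.mem_nhds hp)).hasFDerivAt
  have hx : ∀ p ∈ O, HasDerivAt (fun s => u s p.2) (fderiv ℝ f p (1, 0)) p.1 := by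
    intro p hp
    have h1 : HasDerivAt (fun s : ℝ => (s, p.2)) ((1:ℝ), (0:ℝ)) p.1 :=
      (hasDerivAt_id p.1).prodMk (hasDerivAt_const _ _)
    exact (hd p hp).comp_hasDerivAt p.1 (f := fun s : ℝ => (s, p.2)) h1
  have hy : ∀ p ∈ O, HasDerivAt (fun s => u p.1 s) (fderiv ℝ f p (0, 1)) p.2 := by
    intro p hp
    have h1 : HasDerivAt (fun s : ℝ => (p.1, s)) ((0:ℝ), (1:ℝ)) p.2 :=
      (hasDerivAt_const _ _).prodMk (hasDerivAt_id p.2)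
    exact (hd p hp).comp_hasDerivAt p.2 (f := fun s : ℝ => (p.1, s)) h1
  have ex : ∀ p ∈ O, pdx u p.1 p.2 = fderiv ℝ f p (1, 0) := fun p hp => (hx p hp).deriv
  have ey : ∀ p ∈ O, pdy u p.1 p.2 = fderiv ℝ f p (0, 1) := fun p hp => (hy p hp).deriv
  have hff : ContDiffOn ℝ 1 (fderiv ℝ f) O := hs.fderiv_of_isOpen hO (by norm_num)
  have hffd : DifferentiableAt ℝ (fderiv ℝ f) (x, y) :=
    (hff.differentiableOn (by norm_num)).differentiableAt (hO.mem_nhds hp)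
  have cx : Tendsto (fun s : ℝ => (s, y)) (𝓝 x) (𝓝 (x, y)) :=
    (Continuous.prodMk_left y).tendsto x
  have cy : Tendsto (fun s : ℝ => (x, s)) (𝓝 y) (𝓝 (x, y)) :=
    (Continuous.prodMk_right x).tendsto y
  have evx : ∀ᶠ t in 𝓝 x, (t, y) ∈ O := cx.eventually (hO.mem_nhds hp)
  have evy : ∀ᶠ t in 𝓝 y, (x, t) ∈ O := cy.eventually (hO.mem_nhds hp)
  have dx : DifferentiableAt ℝ (fun t => pdx u t y) x := by
    have : (fun t => pdx u t y) =ᶠ[𝓝 x] fun t => fderiv ℝ f (t, y) (1, 0) :=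
      evx.mono fun t ht => ex (t, y) ht
    rw [this.differentiableAt_iff]
    have h2 : DifferentiableAt ℝ (fun t : ℝ => fderiv ℝ f (t, y)) x :=
      DifferentiableAt.comp x (g := fderiv ℝ f) (f := fun t : ℝ => (t, y)) hffd (by fun_prop)
    exact h2.clm_apply (by fun_prop)
  have dy : DifferentiableAt ℝ (fun t => pdy u x t) y := by
    have : (fun t => pdy u x t) =ᶠ[𝓝 y] fun t => fderiv ℝ f (x, t) (0, 1) :=
      evy.mono fun t ht => ey (x, t) ht
    rw [this.differentiableAt_iff]
    have h2 : DifferentiableAt ℝ (fun t : ℝ => fderiv ℝ f (x, t)) y :=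
      DifferentiableAt.comp y (g := fderiv ℝ f) (f := fun t : ℝ => (x, t)) hffd (by fun_prop)
    exact h2.clm_apply (by fun_prop)
  refine ⟨⟨fun t => pdx u t y, fun t => pdy u x t, pdxx u x y, pdyy u x y, ?_, dx.hasDerivAt, ?_,
    dy.hasDerivAt, rfl⟩, ?_⟩
  · filter_upwards [evx] with t ht
    have := hx (t, y) ht
    rw [← ex (t, y) ht] at this
    exact this
  · filter_upwards [evy] with t ht
    have := hy (x, t) ht
    rw [← ey (x, t) ht] at this
    exact this
  · convert hd (x, y) hp using 1
    have e1 := ex (x, y) hp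
    have e2 := ey (x, y) hp
    simp only at e1 e2
    rw [e1, e2]
    ext <;> simp

theorem mk_cfg (d D μ c : ℝ) (hd : 0 < d)
    (u : ℝ → ℝ → ℝ) (hu : OneSpeciesTW d D μ c u)
    (hLip : ∃ K : NNReal, LipschitzOnWith K (fun p : ℝ × ℝ => u p.1 p.2) lowerH)
    (hmono : ∀ p ∈ posSet u, pdx u p.1 p.2 < 0)
    (φ : ℝ → ℝ)
    (hφa : AnalyticOnNhd ℝ φ (Iio 0))
    (hΓ : freeBdry u = {p : ℝ × ℝ | ∃ y < (0:ℝ), p = (φ y, y)}) :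
    ∃ k K G₁ G₂, Cfg k K u φ G₁ G₂ := by
  have hop : IsOpen (posSet u ∩ {p : ℝ × ℝ | p.2 < 0}) := by
    obtain ⟨V, hV, he⟩ := hu.relOpen
    have : posSet u ∩ {p : ℝ × ℝ | p.2 < 0} = V ∩ {p : ℝ × ℝ | p.2 < 0} := by
      rw [he]; ext p; simp only [lowerH, mem_inter_iff, mem_ofPred_eq]
      constructor
      · rintro ⟨⟨a, _⟩, b⟩; exact ⟨a, b⟩
      · rintro ⟨a, b⟩; exact ⟨⟨a, b.le⟩, b⟩
    rw [this]
    exact hV.inter (isOpen_lt continuous_snd continuous_const)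
  have hom := pos_iff hu hmono hΓ hop
  obtain ⟨K, hK⟩ := hLip
  obtain ⟨G₁, G₂, g1, g2, g3, g4⟩ := hu.grad_ext
  have hsub : {p : ℝ × ℝ | p.2 < 0 ∧ p.1 ≤ φ p.2} ⊆ posSet u ∪ freeBdry u := by
    rintro ⟨x, y⟩ ⟨hy, hx⟩
    simp only at hy hx
    rcases hx.lt_or_eq with h | h
    · exact Or.inl ⟨hy.le, (hom x y hy).2 h⟩
    · right; rw [hΓ]; exact ⟨y, hy, by rw [← h]⟩
  have hmem : ∀ x y, y < 0 → x < φ y → (x, y) ∈ posSet u ∩ {p : ℝ × ℝ | p.2 < 0} :=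
    fun x y hy hx => ⟨⟨hy.le, (hom x y hy).2 hx⟩, hy⟩
  refine ⟨c / d, K, G₁, G₂, ⟨div_pos hu.c_pos hd, hom, fun x y hy => (hu.mem01 x y hy.le).1,
    fun x y hy => (hu.mem01 x y hy.le).2, ?_, ?_, ?_, g1.mono hsub, g2.mono hsub, ?_, ?_, ?_, ?_, hφa⟩⟩
  · intro x y hy hx
    have := (mk_hasL (k := 0) hop hu.smooth (hmem x y hy hx)).2
    rw [(g3 _ (hmem x y hy hx)).1, (g3 _ (hmem x y hy hx)).2]
    exact this
  · intro x y hy hx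
    refine (mk_hasL (k := c / d) hop hu.smooth (hmem x y hy hx)).1.congr_l ?_
    have := hu.pde _ (hmem x y hy hx)
    simp only at this
    field_simp
    linarith
  · exact hu.cont.mono fun p hp => (show p.2 ≤ 0 from le_of_lt hp)
  · intro x y hy hx
    rw [(g3 _ (hmem x y hy hx)).1]
    exact hmono _ (hmem x y hy hx).1
  · intro y hy
    exact g4 _ (by rw [hΓ]; exact ⟨y, hy, rfl⟩)
  · intro x y hy hx
    rw [(g3 _ (hmem x y hy hx)).2]
    have hl : LipschitzOnWith K (fun s => u x s) (Iio 0) := by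
      intro a ha b hb
      have := hK (x := (x, a)) (by simpa [lowerH] using le_of_lt ha) (y := (x, b))
        (by simpa [lowerH] using le_of_lt hb)
      simpa [Prod.edist_eq] using this
    have := norm_deriv_le_of_lipschitzOn (Iio_mem_nhds hy) hl
    exact this
  · intro ε hε
    obtain ⟨M, hM⟩ := hu.lim_left ε hε
    exact ⟨M, fun x hx y hy => hM x hx y hy.le⟩

namespace Cfg
variable {k K : ℝ} {u : ℝ → ℝ → ℝ} {φ : ℝ → ℝ} {G₁ G₂ : ℝ × ℝ → ℝ}

theorem phi_at (C : Cfg k K u φ G₁ G₂) {y : ℝ} (hy : y < 0) : AnalyticAt ℝ φ y := C.ana y hy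

theorem phi_d (C : Cfg k K u φ G₁ G₂) {y : ℝ} (hy : y < 0) : HasDerivAt φ (deriv φ y) y :=
  (C.phi_at hy).differentiableAt.hasDerivAt

theorem phi_cont (C : Cfg k K u φ G₁ G₂) : ContinuousOn φ (Iio 0) := C.ana.continuousOn

theorem zero (C : Cfg k K u φ G₁ G₂) {y : ℝ} (hy : y < 0) : u (φ y) y = 0 := by
  have := C.om (φ y) y hy
  have h2 := C.u0 (φ y) y hy
  rcases h2.lt_or_eq with h | h
  · exact absurd (this.1 h) (lt_irrefl _)
  · exact h.symm

/-- derivative of u along a differentiable path -/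
theorem path (C : Cfg k K u φ G₁ G₂) {X Y : ℝ → ℝ} {X' Y' t : ℝ} (hX : HasDerivAt X X' t)
    (hY : HasDerivAt Y Y' t) (hy : Y t < 0) (hx : X t < φ (Y t)) :
    HasDerivAt (fun s => u (X s) (Y s)) (G₁ (X t, Y t) * X' + G₂ (X t, Y t) * Y') t := by
  have := (C.fd (X t) (Y t) hy hx).comp_hasDerivAt t (f := fun s => (X s, Y s)) (hX.prodMk hY)
  exact this.congr_deriv (by simp)

theorem ucontAt (C : Cfg k K u φ G₁ G₂) {x y : ℝ} (hy : y < 0) :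
    ContinuousAt (fun p : ℝ × ℝ => u p.1 p.2) (x, y) :=
  C.ucont.continuousAt ((isOpen_lt continuous_snd continuous_const).mem_nhds hy)

/-- `G₁ φ' + G₂` tested at a boundary point by small boxes. -/
theorem tang_aux (C : Cfg k K u φ G₁ G₂) {y0 : ℝ} (hy0 : y0 < 0) (sg : ℝ)
    (h : 0 < sg * (G₁ (φ y0, y0) * deriv φ y0 + G₂ (φ y0, y0))) : False := by
  set lam := sg * (G₁ (φ y0, y0) * deriv φ y0 + G₂ (φ y0, y0)) with hlam
  -- function on the closed domain in coordinates (h,y)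
  let D : Set (ℝ × ℝ) := {p | 0 ≤ p.1 ∧ p.2 < 0}
  let T : ℝ × ℝ → ℝ × ℝ := fun p => (φ p.2 - p.1, p.2)
  have hT : ContinuousOn T D := by
    have h1 : ContinuousOn (fun p : ℝ × ℝ => φ p.2) D :=
      C.phi_cont.comp continuousOn_snd (fun p hp => hp.2)
    exact (h1.sub continuousOn_fst).prodMk continuousOn_snd
  have hTm : MapsTo T D {p | p.2 < 0 ∧ p.1 ≤ φ p.2} := by
    rintro p ⟨hp1, hp2⟩
    refine ⟨hp2, ?_⟩
    simp only [T]; linarith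
  have hF : ContinuousOn (fun p : ℝ × ℝ => sg * (G₁ (T p) * deriv φ p.2 + G₂ (T p))) D := by
    have h1 : ContinuousOn (fun p : ℝ × ℝ => deriv φ p.2) D :=
      C.ana.deriv.continuousOn.comp continuousOn_snd (fun p hp => hp.2)
    exact continuousOn_const.mul (((C.c1.comp hT hTm).mul h1).add (C.c2.comp hT hTm))
  have hc := hF (0, y0) ⟨le_refl _, hy0⟩
  have hval : sg * (G₁ (T (0, y0)) * deriv φ y0 + G₂ (T (0, y0))) = lam := by
    simp [T, hlam]
  have hev : ∀ᶠ p in 𝓝[D] ((0:ℝ), y0), lam / 2 < sg * (G₁ (T p) * deriv φ p.2 + G₂ (T p)) := by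
    apply hc.eventually_const_lt
    simp only
    rw [hval]; linarith
  obtain ⟨r, hr, hball⟩ := Metric.mem_nhdsWithin_iff.1 hev
  set s := min (r/2) (-y0/2) with hs
  have hs0 : 0 < s := lt_min (by linarith) (by linarith)
  have hs1 : s < r := lt_of_le_of_lt (min_le_left _ _) (by linarith)
  have hs2 : y0 + s < 0 := by have := min_le_right (r/2) (-y0/2); linarith
  have key : ∀ h, 0 < h → h < r →
      s * (lam / 2) ≤ sg * (u (φ (y0 + s) - h) (y0 + s) - u (φ y0 - h) y0) := by
    intro h h0 h1
    have hd : ∀ y, y < 0 → HasDerivAt (fun y => sg * u (φ y - h) y)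
        (sg * (G₁ (φ y - h, y) * deriv φ y + G₂ (φ y - h, y) * 1)) y := by
      intro y hy
      exact (C.path (X := fun y => φ y - h) (Y := fun y => y) ((C.phi_d hy).sub_const h)
        (hasDerivAt_id y) hy (by simp; exact h0)).const_mul sg
    obtain ⟨z, hz, hz2⟩ := exists_hasDerivAt_eq_slope (fun y => sg * u (φ y - h) y)
      (fun y => sg * (G₁ (φ y - h, y) * deriv φ y + G₂ (φ y - h, y) * 1))
      (show y0 < y0 + s by linarith)
      (fun y hy => (hd y (by linarith [hy.2])).continuousAt.continuousWithinAt)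
      (fun y hy => hd y (by linarith [hy.2]))
    have hb := hball (show ((h, z) : ℝ × ℝ) ∈ Metric.ball ((0:ℝ), y0) r ∩ D from by
      refine ⟨?_, h0.le, by simp only; linarith [hz.2]⟩
      rw [Metric.mem_ball, Prod.dist_eq, Real.dist_eq, Real.dist_eq, max_lt_iff]
      simp only [sub_zero]
      rw [abs_of_pos h0, abs_of_pos (by linarith [hz.1])]
      exact ⟨h1, by linarith [hz.2]⟩)
    simp only [T, mem_ofPred_eq] at hb
    rw [mul_one] at hz2
    rw [hz2, lt_div_iff₀ (by linarith)] at hb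
    nlinarith [hb]
  -- limit h → 0
  have lim : ∀ y, y < 0 → Tendsto (fun h => u (φ y - h) y) (𝓝[>] 0) (𝓝 0) := by
    intro y hy
    have h1 : Tendsto (fun h : ℝ => (φ y - h, y)) (𝓝[>] 0) (𝓝 (φ y, y)) := by
      have : Continuous (fun h : ℝ => (φ y - h, y)) := by fun_prop
      have := this.tendsto 0
      simp only [sub_zero] at this
      exact this.mono_left nhdsWithin_le_nhds
    have := (C.ucontAt (x := φ y) hy).tendsto.comp h1
    simp only [C.zero hy] at this
    exact this
  have l2 := ((lim (y0 + s) hs2).sub (lim y0 hy0)).const_mul sg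
  simp only [sub_zero, mul_zero] at l2
  have : s * (lam / 2) ≤ 0 := by
    apply ge_of_tendsto l2
    filter_upwards [Ioo_mem_nhdsGT hr] with h hh using key h hh.1 hh.2
  nlinarith

theorem tang (C : Cfg k K u φ G₁ G₂) {y : ℝ} (hy : y < 0) :
    G₂ (φ y, y) = - (G₁ (φ y, y) * deriv φ y) := by
  rcases lt_trichotomy (G₁ (φ y, y) * deriv φ y + G₂ (φ y, y)) 0 with h | h | h
  · exact (C.tang_aux hy (-1) (by linarith)).elim
  · linarith
  · exact (C.tang_aux hy 1 (by linarith)).elim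

theorem G1_nonpos (C : Cfg k K u φ G₁ G₂) {y : ℝ} (hy : y < 0) : G₁ (φ y, y) ≤ 0 := by
  have hc := C.c1 (φ y, y) ⟨hy, le_refl _⟩
  have h1 : Tendsto (fun h : ℝ => (φ y - h, y)) (𝓝[>] 0)
      (𝓝[{p | p.2 < 0 ∧ p.1 ≤ φ p.2}] (φ y, y)) := by
    apply tendsto_nhdsWithin_of_tendsto_nhds_of_eventually_within
    · have : Continuous (fun h : ℝ => (φ y - h, y)) := by fun_prop
      have := this.tendsto 0
      simp only [sub_zero] at this
      exact this.mono_left nhdsWithin_le_nhds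
    · filter_upwards [self_mem_nhdsWithin] with h hh
      have : (0:ℝ) < h := hh
      exact ⟨hy, show φ y - h ≤ φ y by linarith⟩
  apply le_of_tendsto (hc.tendsto.comp h1)
  filter_upwards [self_mem_nhdsWithin] with h hh
  have : (0:ℝ) < h := hh
  exact (C.gneg _ _ hy (by linarith)).le

theorem G1_eq (C : Cfg k K u φ G₁ G₂) {y : ℝ} (hy : y < 0) :
    G₁ (φ y, y) = - (√(1 + deriv φ y ^ 2))⁻¹ := by
  have h1 := C.gG y hy
  rw [C.tang hy] at h1
  have h2 := C.G1_nonpos hy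
  have hq : 0 < √(1 + deriv φ y ^ 2) := Real.sqrt_pos.2 (by positivity)
  have hq2 : √(1 + deriv φ y ^ 2) ^ 2 = 1 + deriv φ y ^ 2 := Real.sq_sqrt (by positivity)
  set q := √(1 + deriv φ y ^ 2)
  have h3 : (G₁ (φ y, y) * q) ^ 2 = 1 := by rw [mul_pow, hq2]; linarith
  have h4 : G₁ (φ y, y) * q = -1 := by
    have : G₁ (φ y, y) * q ≤ 0 := mul_nonpos_of_nonpos_of_nonneg h2 hq.le
    nlinarith
  field_simp
  linarith

theorem G2_eq (C : Cfg k K u φ G₁ G₂) {y : ℝ} (hy : y < 0) :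
    G₂ (φ y, y) = deriv φ y * (√(1 + deriv φ y ^ 2))⁻¹ := by
  rw [C.tang hy, C.G1_eq hy]; ring

end Cfg

theorem hasL_poly (k A B c0 x0 y0 x y : ℝ) :
    HasL k (fun x y => A * (x - x0) ^ 2 + B * (y - y0) ^ 2 + c0 * (y - y0)) x y
      (2 * A + 2 * B - 2 * k * A * (x - x0)) := by
  refine (HasL.of_all (fun t => 2 * A * (t - x0)) (fun t => 2 * B * (t - y0) + c0)
    (2 * A) (2 * B) ?_ ?_ ?_ ?_).congr_l (by ring)
  · intro t
    have h := ((((hasDerivAt_id t).sub_const x0).pow 2).const_mul A).add_const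
      (B * (y - y0) ^ 2 + c0 * (y - y0))
    refine (h.congr_deriv (by simp; ring)).congr_of_eventuallyEq (.of_forall fun s => ?_)
    simp; ring
  · have h := (((hasDerivAt_id x).sub_const x0).const_mul (2 * A))
    exact h.congr_deriv (by simp)
  · intro t
    have h := (((((hasDerivAt_id t).sub_const y0).pow 2).const_mul B).add
      (((hasDerivAt_id t).sub_const y0).const_mul c0)).const_add (A * (x - x0) ^ 2)
    refine (h.congr_deriv (by simp; ring)).congr_of_eventuallyEq (.of_forall fun s => ?_)
    simp; ring
  · have h := (((hasDerivAt_id y).sub_const y0).const_mul (2 * B)).add_const c0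
    exact h.congr_deriv (by simp)

theorem hasL_log (k x y : ℝ) (hy : y < 0) :
    HasL k (fun _ y => Real.log (1 - y)) x y (- (1 / (1 - y) ^ 2)) := by
  refine ⟨fun _ => 0, fun t => - (1 - t)⁻¹, 0, - (1 / (1 - y) ^ 2), ?_, ?_, ?_, ?_, by ring⟩
  · exact .of_forall fun t => hasDerivAt_const _ _
  · exact hasDerivAt_const _ _
  · filter_upwards [Iio_mem_nhds hy] with t ht
    have ht : t < 0 := ht
    have h := ((hasDerivAt_id t).const_sub 1).log (by simp; linarith)
    exact h.congr_deriv (by simp; ring)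
  · have h := (((hasDerivAt_id y).const_sub 1).inv (by simp; linarith)).neg
    exact h.congr_deriv (by simp)

namespace Cfg
variable {k K : ℝ} {u : ℝ → ℝ → ℝ} {φ : ℝ → ℝ} {G₁ G₂ : ℝ × ℝ → ℝ}

theorem grad_left (C : Cfg k K u φ G₁ G₂) {y1 : ℝ} (hy1 : y1 < 0) :
    ∃ M, ∀ x ≤ M, ∀ y ≤ y1, x < φ y ∧ |G₂ (x, y)| ≤ 1 / 4 := by
  have hk := C.kpos
  set r := -y1 / 2 with hr
  have hr0 : 0 < r := by rw [hr]; linarith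
  set m := 2 + k * r with hm
  have hm0 : 2 < m := by have := mul_pos hk hr0; linarith
  set δ := min (1/2) (r / (2 * (m + 1))) with hδ
  have hδ0 : 0 < δ := lt_min (by norm_num) (by positivity)
  have hδ1 : δ ≤ 1/2 := min_le_left _ _
  have hδ2 : δ * (m + 1) / r ≤ 1 / 2 := by
    have : δ ≤ r / (2 * (m + 1)) := min_le_right _ _
    rw [le_div_iff₀ (by positivity)] at this
    rw [div_le_iff₀ hr0]; linarith
  obtain ⟨M, hM⟩ := C.left δ hδ0
  have hin : ∀ x ≤ M, ∀ y < 0, x < φ y := by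
    intro x hx y hy
    rw [← C.om x y hy]
    have := (abs_lt.1 (hM x hx y hy)).1
    linarith
  refine ⟨M - r, fun x0 hx0 y0 hy0 => ⟨hin _ (by linarith) _ (by linarith), ?_⟩⟩
  have hy0n : y0 < 0 := by linarith
  have main : ∀ sg : ℝ, sg = 1 ∨ sg = -1 → sg * G₂ (x0, y0) ≤ 1 / 4 := by
    intro sg hsg
    let U : ℝ → ℝ → ℝ := fun x s => u (x + 0) (s + y0) + (-1) * u x (y0 - s)
    let W : ℝ → ℝ → ℝ := fun x s =>
      ((δ / r ^ 2) * (x - x0) ^ 2 + (-(δ / r ^ 2) * m) * (s - 0) ^ 2 +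
        ((δ / r ^ 2) * ((m + 1) * r)) * (s - 0)) + (-sg) * U x s
    let Q : Set (ℝ × ℝ) := Icc (x0 - r) (x0 + r) ×ˢ Icc 0 r
    have hUb : ∀ x s, x ≤ x0 + r → 0 ≤ s → s ≤ r → -δ ≤ sg * U x s ∧ sg * U x s ≤ δ := by
      intro x s hx hs hs2
      have n1 : s + y0 < 0 := by rw [hr] at hs2; linarith
      have n2 : y0 - s < 0 := by linarith
      have a1 := (abs_lt.1 (hM x (by linarith) _ n1)).1
      have a2 := (abs_lt.1 (hM x (by linarith) _ n2)).1
      have a3 := C.u1 x _ n1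
      have a4 := C.u1 x _ n2
      simp only [U, add_zero]
      rcases hsg with h | h <;> rw [h] <;> constructor <;> linarith
    have hQc : IsCompact Q := isCompact_Icc.prod isCompact_Icc
    have hWc : ContinuousOn (fun p : ℝ × ℝ => W p.1 p.2) Q := by
      have hU1 : ContinuousOn (fun p : ℝ × ℝ => u (p.1 + 0) (p.2 + y0)) Q := by
        refine C.ucont.comp (f := fun p : ℝ × ℝ => (p.1 + 0, p.2 + y0)) (by fun_prop) ?_
        rintro p ⟨_, hp⟩
        show p.2 + y0 < 0
        have := hp.2; rw [hr] at this; linarith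
      have hU2 : ContinuousOn (fun p : ℝ × ℝ => u p.1 (y0 - p.2)) Q := by
        refine C.ucont.comp (f := fun p : ℝ × ℝ => (p.1, y0 - p.2)) (by fun_prop) ?_
        rintro p ⟨_, hp⟩
        show y0 - p.2 < 0
        have := hp.1; linarith
      apply ContinuousOn.add
      · fun_prop
      · exact continuousOn_const.mul (hU1.add (continuousOn_const.mul hU2))
    obtain ⟨p, hpQ, hpmin⟩ := hQc.exists_isMinOn ⟨(x0, 0), by
      constructor <;> simp <;> linarith⟩ hWc
    have hge : 0 ≤ W p.1 p.2 := by
      by_contra hneg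
      push Not at hneg
      obtain ⟨⟨p1, p2⟩, p3, p4⟩ := hpQ
      have hub := hUb p.1 p.2 p2 p3 p4
      have hδr : 0 < δ / r ^ 2 := by positivity
      have hWe : W p.1 p.2 = (δ / r ^ 2) * ((p.1 - x0) ^ 2 + p.2 * ((m + 1) * r - m * p.2))
          - sg * U p.1 p.2 := by simp only [W]; ring
      have hnn : 0 ≤ p.2 * ((m + 1) * r - m * p.2) := mul_nonneg p3 (by nlinarith)
      have hcase : r ^ 2 ≤ (p.1 - x0) ^ 2 + p.2 * ((m + 1) * r - m * p.2) → False := by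
        intro h
        have := mul_le_mul_of_nonneg_left h hδr.le
        rw [div_mul_cancel₀ _ (by positivity)] at this
        linarith
      have e1 : p.1 ≠ x0 - r := fun h => hcase (by rw [h]; ring_nf; ring_nf at hnn; linarith)
      have e2 : p.1 ≠ x0 + r := fun h => hcase (by rw [h]; ring_nf; ring_nf at hnn; linarith)
      have e3 : p.2 ≠ 0 := fun h => by
        have : W p.1 p.2 = (δ / r ^ 2) * (p.1 - x0) ^ 2 := by rw [h]; simp [W, U]
        have : 0 ≤ W p.1 p.2 := by rw [this]; positivity
        linarith
      have e4 : p.2 ≠ r := fun h => hcase (by rw [h]; nlinarith [sq_nonneg (p.1 - x0)])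
      have q1 := lt_of_le_of_ne p1 (Ne.symm e1)
      have q2 := lt_of_le_of_ne p2 e2
      have q3 := lt_of_le_of_ne p3 (Ne.symm e3)
      have q4 := lt_of_le_of_ne p4 e4
      have hloc : IsLocalMin (fun p : ℝ × ℝ => W p.1 p.2) (p.1, p.2) := by
        apply hpmin.isLocalMin
        exact prod_mem_nhds (Icc_mem_nhds q1 q2) (Icc_mem_nhds q3 q4)
      have n1 : p.2 + y0 < 0 := by rw [hr] at q4; linarith
      have n2 : y0 - p.2 < 0 := by linarith
      have hL1 := (C.hasL (p.1 + 0) (p.2 + y0) n1 (hin _ (by linarith) _ n1)).shift 0 y0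
      have hL2 := (C.hasL p.1 (y0 - p.2) n2 (hin _ (by linarith) _ n2)).reflect y0
      have hL := (hasL_poly k (δ / r ^ 2) (-(δ / r ^ 2) * m) ((δ / r ^ 2) * ((m + 1) * r)) x0 0
        p.1 p.2).add ((hL1.add (hL2.const_mul (-1))).const_mul (-sg))
      have := HasL.min_test hL hloc
      have h3 : 0 ≤ (δ / r ^ 2) * (2 - 2 * m - 2 * k * (p.1 - x0)) := by linarith
      have h4 := nonneg_of_mul_nonneg_right h3 hδr
      have h5 : k * (x0 - p.1) ≤ k * r := mul_le_mul_of_nonneg_left (by linarith) hk.le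
      nlinarith
    have hder : HasDerivAt (fun s => W x0 s)
        ((δ / r ^ 2) * ((m + 1) * r) + (-sg) * (2 * G₂ (x0, y0))) 0 := by
      have hx00 : x0 < φ y0 := hin _ (by linarith) _ (by linarith)
      have d1 := C.path (X := fun _ => x0 + 0) (Y := fun s => s + y0) (t := 0)
        (hasDerivAt_const _ _) ((hasDerivAt_id 0).add_const y0) (by simpa using hy0n)
        (by simpa using hx00)
      have d2 := C.path (X := fun _ => x0) (Y := fun s => y0 - s) (t := 0)
        (hasDerivAt_const _ _) ((hasDerivAt_id 0).const_sub y0) (by simpa using hy0n)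
        (by simpa using hx00)
      obtain d3 := (hasDerivAt_id (0:ℝ)).sub_const 0
      have d4 := (((d3.pow 2).const_mul (-(δ / r ^ 2) * m)).const_add
        ((δ / r ^ 2) * (x0 - x0) ^ 2)).add (d3.const_mul ((δ / r ^ 2) * ((m + 1) * r)))
      have d5 := d4.add ((d1.add (d2.const_mul (-1))).const_mul (-sg))
      refine d5.congr_deriv ?_
      simp; left; ring
    have hfin := deriv_nonneg_of_right hr0 hder (by simp [W, U]) (by
      intro s hs hs2
      have : W p.1 p.2 ≤ W x0 s := hpmin (show ((x0, s) : ℝ × ℝ) ∈ Q by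
        constructor <;> constructor <;> simp <;> linarith)
      linarith)
    have e : (δ / r ^ 2) * ((m + 1) * r) = δ * (m + 1) / r := by field_simp
    rw [e] at hfin
    linarith
  rw [abs_le]
  constructor
  · linarith [main (-1) (Or.inr rfl)]
  · linarith [main 1 (Or.inl rfl)]

end Cfg

namespace Cfg
variable {k K : ℝ} {u : ℝ → ℝ → ℝ} {φ : ℝ → ℝ} {G₁ G₂ : ℝ × ℝ → ℝ}

theorem isOpen_om (C : Cfg k K u φ G₁ G₂) : IsOpen {p : ℝ × ℝ | p.2 < 0 ∧ p.1 < φ p.2} := by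
  rw [isOpen_iff_mem_nhds]
  rintro ⟨x, y⟩ ⟨hy, hx⟩
  have hy : y < 0 := hy
  have h1 : ContinuousAt (fun p : ℝ × ℝ => φ p.2) (x, y) :=
    ContinuousAt.comp (f := fun p : ℝ × ℝ => p.2) (C.phi_at hy).continuousAt continuousAt_snd
  have h2 : ∀ᶠ p : ℝ × ℝ in 𝓝 (x, y), p.1 < φ p.2 :=
    (continuousAt_fst (p := ((x, y) : ℝ × ℝ))).eventually_lt h1 hx
  have h3 : ∀ᶠ p : ℝ × ℝ in 𝓝 (x, y), p.2 < 0 :=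
    (continuousAt_snd (p := ((x, y) : ℝ × ℝ))).eventually_lt continuousAt_const hy
  exact h3.and h2

set_option maxHeartbeats 1000000 in
theorem no_int (C : Cfg k K u φ G₁ G₂) {x0 y0 κ a η : ℝ} (hη : 0 < η) (hy0 : y0 < 0)
    (hx0 : x0 < φ y0)
    (hmin : ∀ᶠ p : ℝ × ℝ in 𝓝 (x0, y0),
      -G₁ (x0, y0) - κ * G₂ (x0, y0) - a * u x0 y0 + η * Real.log (1 - y0) ≤
        -G₁ p - κ * G₂ p - a * u p.1 p.2 + η * Real.log (1 - p.2)) : False := by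
  have hk := C.kpos
  set V : ℝ × ℝ → ℝ := fun p => -G₁ p - κ * G₂ p with hV
  set Z0 := V (x0, y0) - a * u x0 y0 + η * Real.log (1 - y0) with hZ0
  have hev := hmin.and (C.isOpen_om.mem_nhds (show (x0, y0) ∈ {p : ℝ × ℝ | p.2 < 0 ∧ p.1 < φ p.2}
    from ⟨hy0, hx0⟩))
  obtain ⟨r0, hr0, hball⟩ := Metric.eventually_nhds_iff.1 hev
  set r := min 1 (r0 / 4) with hr
  have hrp : 0 < r := lt_min one_pos (by linarith)
  have hr1 : r ≤ 1 := min_le_left _ _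
  have hr2 : r ≤ r0 / 4 := min_le_right _ _
  set Q2 := Metric.closedBall ((x0, y0) : ℝ × ℝ) (2 * r) with hQ2
  set Q := Metric.closedBall ((x0, y0) : ℝ × ℝ) r with hQ
  have hQ2in : ∀ p ∈ Q2, Z0 ≤ V p - a * u p.1 p.2 + η * Real.log (1 - p.2) ∧
      p.2 < 0 ∧ p.1 < φ p.2 := by
    intro p hp
    have := @hball p (lt_of_le_of_lt (Metric.mem_closedBall.1 hp) (by linarith))
    exact ⟨this.1, this.2⟩
  have hVc : ContinuousOn V Q2 := by
    have s : Q2 ⊆ {p | p.2 < 0 ∧ p.1 ≤ φ p.2} := fun p hp =>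
      ⟨(hQ2in p hp).2.1, (hQ2in p hp).2.2.le⟩
    exact ((C.c1.mono s).neg).sub (continuousOn_const.mul (C.c2.mono s))
  have hVu := (isCompact_closedBall ((x0, y0) : ℝ × ℝ) (2 * r)).uniformContinuousOn_of_continuous
    hVc
  set lam := η / (2 * (4 + 2 * k) * (2 - y0) ^ 2) with hlam
  have hy2 : 0 < 2 - y0 := by linarith
  have hlamp : 0 < lam := by positivity
  set ν := lam * r ^ 2 / 3 with hν
  have hνp : 0 < ν := by positivity
  obtain ⟨δ, hδ, hδV⟩ := Metric.uniformContinuousOn_iff.1 hVu ν hνp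
  set t := min r δ / (2 * (1 + |κ|)) with ht
  have hκ : 0 < 1 + |κ| := by positivity
  have htp : 0 < t := div_pos (lt_min hrp hδ) (by positivity)
  have ht2 : t * (2 * (1 + |κ|)) = min r δ := by rw [ht]; field_simp
  have htr : t * (2 * (1 + |κ|)) ≤ r := ht2 ▸ min_le_left _ _
  have htδ : t * (2 * (1 + |κ|)) ≤ δ := ht2 ▸ min_le_right _ _
  -- displacement
  have hdist : ∀ p : ℝ × ℝ, ∀ s, 0 ≤ s → s ≤ t → dist (p.1 - s, p.2 - κ * s) p ≤ t * (1 + |κ|) := by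
    intro p s hs hst
    rw [Prod.dist_eq, max_le_iff]
    simp only [Real.dist_eq]
    have e1 : |p.1 - s - p.1| = s := by rw [sub_sub_cancel_left, abs_neg, abs_of_nonneg hs]
    have e2 : |p.2 - κ * s - p.2| = |κ| * s := by
      rw [sub_sub_cancel_left, abs_neg, abs_mul, abs_of_nonneg hs]
    rw [e1, e2]
    have := abs_nonneg κ
    constructor <;> nlinarith
  have hin : ∀ p ∈ Q, ∀ s, 0 ≤ s → s ≤ t → (p.1 - s, p.2 - κ * s) ∈ Q2 := by
    intro p hp s hs hst
    have h1 := hdist p s hs hst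
    have h2 := Metric.mem_closedBall.1 hp
    refine Metric.mem_closedBall.2 ((dist_triangle _ p _).trans ?_)
    linarith
  have hQsub : Q ⊆ Q2 := Metric.closedBall_subset_closedBall (by linarith)
  let Dt : ℝ → ℝ → ℝ := fun x y => (1 / t) * (u (x + -t) (y + -(κ * t)) + (-1) * u x y)
  have hD : ∀ p ∈ Q, |Dt p.1 p.2 - V p| < ν := by
    intro p hp
    have hder : ∀ s ∈ Icc 0 t, HasDerivAt (fun s => u (p.1 - s) (p.2 - κ * s))
        (V (p.1 - s, p.2 - κ * s)) s := by
      intro s hs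
      have hm := hQ2in _ (hin p hp s hs.1 hs.2)
      have h := C.path (X := fun s => p.1 - s) (Y := fun s => p.2 - κ * s) (t := s)
        ((hasDerivAt_id s).const_sub p.1) (((hasDerivAt_id s).const_mul κ).const_sub p.2)
        hm.2.1 hm.2.2
      exact h.congr_deriv (by simp [hV]; ring)
    obtain ⟨s, hs, hse⟩ := exists_hasDerivAt_eq_slope (fun s => u (p.1 - s) (p.2 - κ * s))
      (fun s => V (p.1 - s, p.2 - κ * s)) htp
      (fun s hs => (hder s hs).continuousAt.continuousWithinAt)
      (fun s hs => hder s ⟨hs.1.le, hs.2.le⟩)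
    have e : Dt p.1 p.2 = V (p.1 - s, p.2 - κ * s) := by
      rw [hse]; simp only [Dt, sub_zero, mul_zero, ← sub_eq_add_neg]; ring
    rw [e, ← Real.dist_eq]
    refine hδV _ (hin p hp s hs.1.le hs.2.le) _ (hQsub hp) ?_
    refine (hdist p s hs.1.le hs.2.le).trans_lt ?_
    have : 0 < t * (1 + |κ|) := by positivity
    linarith
  let W : ℝ → ℝ → ℝ := fun x y => ((Dt x y + (-a) * u x y) + η * Real.log (1 - y)) +
    (lam * (x - x0) ^ 2 + lam * (y - y0) ^ 2 + 0 * (y - y0))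
  have hWc : ContinuousOn (fun p : ℝ × ℝ => W p.1 p.2) Q := by
    have hu1 : ContinuousOn (fun p : ℝ × ℝ => u p.1 p.2) Q :=
      C.ucont.mono fun p hp => (hQ2in p (hQsub hp)).2.1
    have hu2 : ContinuousOn (fun p : ℝ × ℝ => u (p.1 + -t) (p.2 + -(κ * t))) Q := by
      refine C.ucont.comp (f := fun p : ℝ × ℝ => (p.1 + -t, p.2 + -(κ * t))) (by fun_prop) ?_
      intro p hp
      have := (hQ2in _ (hin p hp t htp.le le_rfl)).2.1
      simpa [sub_eq_add_neg] using this
    have hlog : ContinuousOn (fun p : ℝ × ℝ => Real.log (1 - p.2)) Q := by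
      apply ContinuousOn.log (by fun_prop)
      intro p hp
      have := (hQ2in p (hQsub hp)).2.1
      linarith
    apply ContinuousOn.add
    · exact ((continuousOn_const.mul (hu2.add (continuousOn_const.mul hu1))).add
        (continuousOn_const.mul hu1)).add (continuousOn_const.mul hlog)
    · fun_prop
  have hp0 : ((x0, y0) : ℝ × ℝ) ∈ Q := Metric.mem_closedBall_self hrp.le
  obtain ⟨p, hpQ, hpmin⟩ := (isCompact_closedBall ((x0, y0) : ℝ × ℝ) r).exists_isMinOn
    ⟨_, hp0⟩ hWc
  have hle : W p.1 p.2 ≤ W x0 y0 := hpmin hp0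
  have a1 := abs_lt.1 (hD p hpQ)
  have a2 := abs_lt.1 (hD _ hp0)
  have a3 := (hQ2in p (hQsub hpQ)).1
  have hsq : lam * ((p.1 - x0) ^ 2 + (p.2 - y0) ^ 2) < lam * r ^ 2 := by
    have e1 : W x0 y0 = Dt x0 y0 - a * u x0 y0 + η * Real.log (1 - y0) := by
      simp only [W]; ring
    have e2 : W p.1 p.2 = Dt p.1 p.2 - a * u p.1 p.2 + η * Real.log (1 - p.2) +
      lam * ((p.1 - x0) ^ 2 + (p.2 - y0) ^ 2) := by
      simp only [W]; ring
    have a2' : Dt x0 y0 - V (x0, y0) < ν := a2.2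
    have : lam * r ^ 2 = 3 * ν := by rw [hν]; ring
    linarith [a1.1]
  have hsq2 := lt_of_mul_lt_mul_left hsq hlamp.le
  have b1 : |p.1 - x0| < r := abs_lt_of_sq_lt_sq (by nlinarith [sq_nonneg (p.2 - y0)]) hrp.le
  have b2 : |p.2 - y0| < r := abs_lt_of_sq_lt_sq (by nlinarith [sq_nonneg (p.1 - x0)]) hrp.le
  have hnh : Q ∈ 𝓝 p := by
    apply mem_of_superset (Metric.isOpen_ball.mem_nhds (?_ : p ∈ Metric.ball (x0, y0) r))
      Metric.ball_subset_closedBall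
    rw [Metric.mem_ball, Prod.dist_eq, max_lt_iff]
    exact ⟨b1, b2⟩
  have hloc : IsLocalMin (fun p : ℝ × ℝ => W p.1 p.2) (p.1, p.2) := hpmin.isLocalMin hnh
  have m1 := (hQ2in p (hQsub hpQ)).2
  have m2 := (hQ2in _ (hin p hpQ t htp.le le_rfl)).2
  have L1 := C.hasL p.1 p.2 m1.1 m1.2
  have L2 : HasL k u (p.1 + -t) (p.2 + -(κ * t)) 0 := C.hasL _ _ m2.1 m2.2
  have L := (((((L2.shift (-t) (-(κ * t))).add (L1.const_mul (-1))).const_mul (1 / t)).add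
    (L1.const_mul (-a))).add ((hasL_log k p.1 p.2 m1.1).const_mul η)).add
    (hasL_poly k lam lam 0 x0 y0 p.1 p.2)
  have hfin := HasL.min_test L hloc
  have b3 := abs_lt.1 b1
  have b4 := abs_lt.1 b2
  have hη2 : η = lam * (2 * (4 + 2 * k) * (2 - y0) ^ 2) := by rw [hlam]; field_simp
  have hlog : lam * (2 * (4 + 2 * k)) ≤ η * (1 / (1 - p.2) ^ 2) := by
    have : (0:ℝ) < 1 - p.2 := by linarith [m1.1]
    rw [mul_one_div, le_div_iff₀ (by positivity)]
    have h5 : (1 - p.2) ^ 2 ≤ (2 - y0) ^ 2 := by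
      apply pow_le_pow_left₀ this.le; linarith
    have : 0 ≤ lam * (2 * (4 + 2 * k)) := by positivity
    linarith [mul_le_mul_of_nonneg_left h5 this, hη2]
  have h6 : -(k * lam * (p.1 - x0)) ≤ k * lam := by
    have : 0 < k * lam := by positivity
    nlinarith
  have h7 : 0 < k * lam := by positivity
  linarith

end Cfg

set_option maxHeartbeats 1000000 in
theorem room {f f2 q κ ε η g1 k γ0 σ1 : ℝ} (hq : 0 < q) (hq2 : q ^ 2 = 1 + f ^ 2)
    (hγ : γ0 = κ * f - 1) (hγ0 : 0 < γ0) (hκ : κ = ε ∨ κ = -ε) (hε : 0 < ε) (hε1 : ε ≤ 1)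
    (hη : 0 < η) (hηε : η ≤ ε / 16) (hg : |g1| ≤ 1) (h1 : (κ + f) * f2 = η * g1 * q ^ 3)
    (hk : 0 < k) (hεk : ε * (1 + k) < 1 / 8) (hσ : σ1 = -(f * f2) / q ^ 3) :
    ∃ b, 2 * σ1 * f + f2 / q + k / q < b * q ^ 2 ∧ b * γ0 < ε / 4 / q + κ * σ1 := by
  have hκf : 1 < κ * f := by linarith
  have habs : |κ * f| = ε * |f| := by
    rw [abs_mul]; rcases hκ with h | h <;> rw [h] <;> simp [abs_of_pos hε]
  have hκf' : κ * f = ε * |f| := by rw [← habs, abs_of_pos (by linarith)]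
  have hf1 : 1 < ε * |f| := by linarith
  have hfpos : 0 < |f| := by
    by_contra h; push Not at h; nlinarith
  have hfge : 1 < |f| := by nlinarith
  have hfsq : |f| ^ 2 = f ^ 2 := sq_abs f
  have hfq : |f| < q := by
    apply lt_of_pow_lt_pow_left₀ 2 hq.le; rw [hfsq, hq2]; linarith
  have hq2f : q ≤ 2 * |f| := by
    apply (pow_le_pow_iff_left₀ hq.le (by positivity) two_ne_zero).1; rw [mul_pow, hfsq, hq2]; nlinarith
  have hκfa : |f| ≤ |κ + f| := by
    apply (pow_le_pow_iff_left₀ (abs_nonneg _) (abs_nonneg _) two_ne_zero).1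
    rw [sq_abs, sq_abs]; nlinarith [sq_nonneg κ]
  have hf2 : |f2| ≤ 2 * η * q ^ 2 := by
    have e := congrArg abs h1
    rw [abs_mul, abs_mul, abs_mul, abs_of_pos hη, abs_of_pos (by positivity : 0 < q ^ 3)] at e
    have e1 : |f| * |f2| ≤ η * q ^ 3 := by
      calc |f| * |f2| ≤ |κ + f| * |f2| := mul_le_mul_of_nonneg_right hκfa (abs_nonneg _)
        _ = η * |g1| * q ^ 3 := e
        _ ≤ η * 1 * q ^ 3 := by gcongr
        _ = _ := by ring
    have e2 : η * q ^ 3 ≤ |f| * (2 * η * q ^ 2) := by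
      have : 0 ≤ η * q ^ 2 := by positivity
      nlinarith
    exact le_of_mul_le_mul_left (e1.trans e2) hfpos
  have hγq : γ0 ≤ ε * q := by nlinarith
  have hid : (ε / 4 / q + κ * σ1) / γ0 * q ^ 2 - (2 * σ1 * f + f2 / q + k / q) =
      (ε / 4) * q / γ0 - f2 / q * (1 / γ0 + 2 / q ^ 2) - k / q := by
    have hκf3 : κ * f = γ0 + 1 := by linarith
    have hff : f ^ 2 = q ^ 2 - 1 := by linarith
    rw [hσ]
    have e1 : (ε / 4 / q + κ * (-(f * f2) / q ^ 3)) / γ0 * q ^ 2 =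
      (ε / 4) * q / γ0 - (κ * f) * f2 / (q * γ0) := by field_simp; ring
    have e2 : 2 * (-(f * f2) / q ^ 3) * f = - 2 * f ^ 2 * f2 / q ^ 3 := by ring
    rw [e1, e2, hκf3, hff]
    field_simp
    ring
  have hpos : 0 < (ε / 4) * q / γ0 - f2 / q * (1 / γ0 + 2 / q ^ 2) - k / q := by
    have e3 : f2 / q * (1 / γ0 + 2 / q ^ 2) ≤ 2 * η * q / γ0 + 4 * η / q := by
      have : f2 / q ≤ 2 * η * q := by
        rw [div_le_iff₀ hq]; have := (abs_le.1 hf2).2; nlinarith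
      calc f2 / q * (1 / γ0 + 2 / q ^ 2) ≤ 2 * η * q * (1 / γ0 + 2 / q ^ 2) := by gcongr
        _ = _ := by field_simp; ring
    have e4 : 2 * η * q / γ0 ≤ (ε / 8) * q / γ0 := by gcongr; linarith
    have e5 : 1 / 8 ≤ (ε / 8) * q / γ0 := by rw [le_div_iff₀ hγ0]; linarith
    have e6 : (4 * η + k) / q ≤ ε * (1 + k) := by
      rw [div_le_iff₀ hq]
      have h8 : 1 ≤ ε * q := hf1.le.trans (mul_le_mul_of_nonneg_left hfq.le hε.le)
      have h9 := mul_le_mul_of_nonneg_left h8 (by linarith : 0 ≤ 1 + k)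
      linarith
    have e7 : (ε / 4) * q / γ0 = 2 * ((ε / 8) * q / γ0) := by ring
    have e8 : (4 * η + k) / q = 4 * η / q + k / q := by ring
    linarith
  have hlt : (2 * σ1 * f + f2 / q + k / q) / q ^ 2 < (ε / 4 / q + κ * σ1) / γ0 := by
    rw [div_lt_iff₀ (by positivity)]; linarith
  obtain ⟨b, hb1, hb2⟩ := exists_between hlt
  refine ⟨b, ?_, ?_⟩
  · rwa [div_lt_iff₀ (by positivity)] at hb1
  · rwa [lt_div_iff₀ hγ0] at hb2

theorem hasL_bar (k b τ : ℝ) {σ φ : ℝ → ℝ} {x y : ℝ} (hσ : AnalyticAt ℝ σ y)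
    (hφ : AnalyticAt ℝ φ y) :
    HasL k (fun x y => (σ y - τ) * (φ y - x) - b / 2 * (φ y - x) ^ 2) x y
      (-b + deriv (deriv σ) y * (φ y - x) + 2 * deriv σ y * deriv φ y
        + (σ y - τ) * deriv (deriv φ) y - b * deriv φ y ^ 2
        - b * (φ y - x) * deriv (deriv φ) y + k * (σ y - τ - b * (φ y - x))) := by
  refine ⟨fun t => -(σ y - τ) + b * (φ y - t),
    fun t => deriv σ t * (φ t - x) + (σ t - τ) * deriv φ t - b * ((φ t - x) * deriv φ t),
    -b, deriv (deriv σ) y * (φ y - x) + 2 * deriv σ y * deriv φ y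
        + (σ y - τ) * deriv (deriv φ) y - b * deriv φ y ^ 2
        - b * (φ y - x) * deriv (deriv φ) y, ?_, ?_, ?_, ?_, by ring⟩
  · refine .of_forall fun t => ?_
    have h1 := (hasDerivAt_id t).const_sub (φ y)
    have h := (h1.const_mul (σ y - τ)).sub ((h1.pow 2).const_mul (b / 2))
    exact h.congr_deriv (by simp; ring)
  · have h1 := (hasDerivAt_id x).const_sub (φ y)
    have h := (h1.const_mul b).const_add (-(σ y - τ))
    exact h.congr_deriv (by simp)
  · filter_upwards [hσ.eventually_analyticAt, hφ.eventually_analyticAt] with t h1 h2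
    have d1 := h1.differentiableAt.hasDerivAt.sub_const τ
    have d2 := h2.differentiableAt.hasDerivAt.sub_const x
    have h := (d1.mul d2).sub ((d2.pow 2).const_mul (b / 2))
    exact h.congr_deriv (by simp; ring)
  · have d1 := hσ.differentiableAt.hasDerivAt.sub_const τ
    have d2 := hφ.differentiableAt.hasDerivAt.sub_const x
    have d3 := hσ.deriv.differentiableAt.hasDerivAt
    have d4 := hφ.deriv.differentiableAt.hasDerivAt
    have h := ((d3.mul d2).add (d1.mul d4)).sub ((d2.mul d4).const_mul b)
    exact h.congr_deriv (by ring)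

namespace Cfg
variable {k K : ℝ} {u : ℝ → ℝ → ℝ} {φ : ℝ → ℝ} {G₁ G₂ : ℝ × ℝ → ℝ}

set_option maxHeartbeats 1000000 in
theorem hopf (C : Cfg k K u φ G₁ G₂) {y0 b : ℝ} (hy0 : y0 < 0) {σ : ℝ → ℝ}
    (hσ : AnalyticAt ℝ σ y0) (hσ0 : G₁ (φ y0, y0) = -σ y0)
    (hneg : -b + 2 * deriv σ y0 * deriv φ y0 + σ y0 * deriv (deriv φ) y0 - b * deriv φ y0 ^ 2
      + k * σ y0 < 0)
    (hle : ∀ᶠ p : ℝ × ℝ in 𝓝 (φ y0, y0), p.1 < φ p.2 →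
      u p.1 p.2 ≤ σ p.2 * (φ p.2 - p.1) - b / 2 * (φ p.2 - p.1) ^ 2) : False := by
  have hk := C.kpos
  set x0 := φ y0 with hx0
  have hφ := C.phi_at hy0
  have snd : Tendsto (fun p : ℝ × ℝ => p.2) (𝓝 (x0, y0)) (𝓝 y0) := continuous_snd.tendsto (x0, y0)
  let ℓ : ℝ × ℝ → ℝ := fun p => -b + deriv (deriv σ) p.2 * (φ p.2 - p.1)
    + 2 * deriv σ p.2 * deriv φ p.2
        + σ p.2 * deriv (deriv φ) p.2 - b * deriv φ p.2 ^ 2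
        - b * (φ p.2 - p.1) * deriv (deriv φ) p.2 + k * (σ p.2 - b * (φ p.2 - p.1))
  have cc : ∀ {h : ℝ → ℝ}, AnalyticAt ℝ h y0 → ContinuousAt (fun p : ℝ × ℝ => h p.2) (x0, y0) :=
    fun hh => ContinuousAt.comp (f := fun p : ℝ × ℝ => p.2) hh.continuousAt continuousAt_snd
  have hℓc : ContinuousAt ℓ (x0, y0) := by
    have c1 := cc hσ
    have c2 := cc hσ.deriv
    have c3 := cc hσ.deriv.deriv
    have c4 := cc hφ
    have c5 := cc hφ.deriv
    have c6 := cc hφ.deriv.deriv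
    simp only [ℓ]
    fun_prop
  have hℓ0 : ℓ (x0, y0) < 0 := by
    simp only [ℓ, ← hx0]; ring_nf; ring_nf at hneg; linarith
  obtain ⟨δ, hδ1, hδ2⟩ := exists_between hℓ0
  have hev : ∀ᶠ p : ℝ × ℝ in 𝓝 (x0, y0), ℓ p < δ ∧ AnalyticAt ℝ σ p.2 ∧ p.2 < 0 ∧
      (p.1 < φ p.2 → u p.1 p.2 ≤ σ p.2 * (φ p.2 - p.1) - b / 2 * (φ p.2 - p.1) ^ 2) := by
    filter_upwards [hℓc.eventually_lt continuousAt_const hδ1, snd.eventually hσ.eventually_analyticAt,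
      snd.eventually (Iio_mem_nhds hy0), hle] with p a1 a2 a3 a4
    exact ⟨a1, a2, a3, a4⟩
  obtain ⟨r0, hr0, hball⟩ := Metric.eventually_nhds_iff.1 hev
  set r := r0 / 2 with hr
  have hrp : 0 < r := by positivity
  set Q := Metric.closedBall ((x0, y0) : ℝ × ℝ) r with hQ
  have hQin : ∀ p ∈ Q, ℓ p < δ ∧ AnalyticAt ℝ σ p.2 ∧ p.2 < 0 ∧
      (p.1 < φ p.2 → u p.1 p.2 ≤ σ p.2 * (φ p.2 - p.1) - b / 2 * (φ p.2 - p.1) ^ 2) :=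
    fun p hp => @hball p (lt_of_le_of_lt (Metric.mem_closedBall.1 hp) (by linarith))
  have hQc : IsCompact Q := isCompact_closedBall _ _
  have hφc : ContinuousOn (fun p : ℝ × ℝ => φ p.2) Q :=
    C.phi_cont.comp continuousOn_snd (fun p hp => (hQin p hp).2.2.1)
  have hσc : ContinuousOn (fun p : ℝ × ℝ => σ p.2) Q := by
    intro p hp
    exact (ContinuousAt.comp (f := fun p : ℝ × ℝ => p.2) (hQin p hp).2.1.continuousAt
      continuousAt_snd).continuousWithinAt
  have hGc : ContinuousOn (fun p : ℝ × ℝ => φ p.2 - p.1) Q := hφc.sub continuousOn_fst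
  obtain ⟨B, hB⟩ := hQc.bddAbove_image hGc
  set M := max B 0 / r ^ 2 with hM
  have hMr : M * r ^ 2 = max B 0 := by rw [hM]; field_simp
  have hGB : ∀ p ∈ Q, φ p.2 - p.1 ≤ M * r ^ 2 := fun p hp => by
    rw [hMr]; exact (hB (mem_image_of_mem _ hp)).trans (le_max_left _ _)
  have hM0 : 0 ≤ M := by positivity
  have hTc : ContinuousOn (fun p : ℝ × ℝ => -(deriv (deriv φ) p.2 + k) +
      M * (4 - 2 * k * (p.1 - x0))) Q := by
    have : ContinuousOn (fun p : ℝ × ℝ => deriv (deriv φ) p.2) Q := by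
      have h : ContinuousOn (deriv (deriv φ)) (Iio 0) := C.ana.deriv.deriv.continuousOn
      exact h.comp continuousOn_snd (fun p hp => (hQin p hp).2.2.1)
    fun_prop
  obtain ⟨B2, hB2⟩ := hQc.bddAbove_image hTc
  set τ := -δ / (max B2 0 + 1) with hτ
  have hB2' : 0 < max B2 0 + 1 := by positivity
  have hτp : 0 < τ := div_pos (by linarith) hB2'
  have hτδ : τ * (max B2 0 + 1) = -δ := by rw [hτ]; field_simp
  let W : ℝ → ℝ → ℝ := fun x y =>
    (((σ y - τ) * (φ y - x) - b / 2 * (φ y - x) ^ 2) + (-1) * u x y) +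
      (τ * M * (x - x0) ^ 2 + τ * M * (y - y0) ^ 2 + 0 * (y - y0))
  set S : Set (ℝ × ℝ) := Q ∩ {p | 0 ≤ φ p.2 - p.1} with hS
  have hSc : IsCompact S := by
    apply hQc.of_isClosed_subset _ inter_subset_left
    exact hGc.preimage_isClosed_of_isClosed Metric.isClosed_closedBall isClosed_Ici
  have hWc : ContinuousOn (fun p : ℝ × ℝ => W p.1 p.2) S := by
    have hu1 : ContinuousOn (fun p : ℝ × ℝ => u p.1 p.2) Q :=
      C.ucont.mono fun p hp => (hQin p hp).2.2.1
    have : ContinuousOn (fun p : ℝ × ℝ => W p.1 p.2) Q := by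
      apply ContinuousOn.add
      · exact (((hσc.sub continuousOn_const).mul hGc).sub
          (continuousOn_const.mul (hGc.pow 2))).add (continuousOn_const.mul hu1)
      · fun_prop
    exact this.mono inter_subset_left
  have hp0 : ((x0, y0) : ℝ × ℝ) ∈ S := ⟨Metric.mem_closedBall_self hrp.le, by simp [hx0]⟩
  obtain ⟨p, hpS, hpmin⟩ := hSc.exists_isMinOn ⟨_, hp0⟩ hWc
  have hge : 0 ≤ W p.1 p.2 := by
    by_contra hn
    push Not at hn
    obtain ⟨hpQ, hpG⟩ := hpS
    have hpG : 0 ≤ φ p.2 - p.1 := hpG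
    obtain ⟨m1, m2, m3, m4⟩ := hQin p hpQ
    have hτM : 0 ≤ τ * M := by positivity
    have hG : 0 < φ p.2 - p.1 := by
      refine lt_of_le_of_ne hpG fun h => ?_
      have hxp : p.1 = φ p.2 := by linarith
      have e : u p.1 p.2 = 0 := by rw [hxp]; exact C.zero m3
      have : W p.1 p.2 = τ * M * ((p.1 - x0) ^ 2 + (p.2 - y0) ^ 2) := by
        simp only [W]; rw [e, ← h]; ring
      have : 0 ≤ W p.1 p.2 := by rw [this]; positivity
      linarith
    have m5 := m4 (by linarith)
    have hsq : (p.1 - x0) ^ 2 + (p.2 - y0) ^ 2 < r ^ 2 := by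
      by_contra h
      push Not at h
      have h1 := mul_le_mul_of_nonneg_left h hτM
      have h2 := mul_le_mul_of_nonneg_left (hGB p hpQ) hτp.le
      have : W p.1 p.2 = (σ p.2 * (φ p.2 - p.1) - b / 2 * (φ p.2 - p.1) ^ 2) - u p.1 p.2
        - τ * (φ p.2 - p.1) + τ * M * ((p.1 - x0) ^ 2 + (p.2 - y0) ^ 2) := by
        simp only [W]; ring
      linarith
    have b1 : |p.1 - x0| < r := abs_lt_of_sq_lt_sq (by nlinarith [sq_nonneg (p.2 - y0)]) hrp.le
    have b2 : |p.2 - y0| < r := abs_lt_of_sq_lt_sq (by nlinarith [sq_nonneg (p.1 - x0)]) hrp.le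
    have hnh : S ∈ 𝓝 p := by
      have n1 : Metric.ball ((x0, y0) : ℝ × ℝ) r ∈ 𝓝 p := Metric.isOpen_ball.mem_nhds (by
        rw [Metric.mem_ball, Prod.dist_eq, max_lt_iff]
        exact ⟨b1, b2⟩)
      have n2 := C.isOpen_om.mem_nhds (show p ∈ {p : ℝ × ℝ | p.2 < 0 ∧ p.1 < φ p.2} from
        ⟨m3, by linarith⟩)
      filter_upwards [n1, n2] with z h1 h2
      exact ⟨Metric.ball_subset_closedBall h1, by have := h2.2; show 0 ≤ φ z.2 - z.1; linarith⟩
    have hloc : IsLocalMin (fun p : ℝ × ℝ => W p.1 p.2) (p.1, p.2) := hpmin.isLocalMin hnh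
    have L := ((hasL_bar k b τ (x := p.1) m2 (C.phi_at m3)).add
      ((C.hasL p.1 p.2 m3 (by linarith)).const_mul (-1))).add
      (hasL_poly k (τ * M) (τ * M) 0 x0 y0 p.1 p.2)
    have hfin := HasL.min_test L hloc
    have hT : -(deriv (deriv φ) p.2 + k) + M * (4 - 2 * k * (p.1 - x0)) ≤ max B2 0 :=
      (hB2 (mem_image_of_mem _ hpQ)).trans (le_max_left _ _)
    have hT2 := mul_le_mul_of_nonneg_left hT hτp.le
    have hfe : 0 ≤ ℓ p + τ * (-(deriv (deriv φ) p.2 + k) + M * (4 - 2 * k * (p.1 - x0))) := by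
      simp only [ℓ]; ring_nf; ring_nf at hfin; linarith
    linarith
  -- the slice
  let F : ℝ → ℝ := fun h => W (x0 - h) y0
  have hF0 : F 0 = 0 := by
    simp only [F, W, sub_zero, ← hx0]
    rw [hx0, C.zero hy0]; ring
  have hFge : ∀ h, 0 ≤ h → h ≤ r → 0 ≤ F h := by
    intro h h1 h2
    refine hge.trans (hpmin (show ((x0 - h, y0) : ℝ × ℝ) ∈ S from ⟨?_, ?_⟩))
    · rw [hQ, Metric.mem_closedBall, Prod.dist_eq]
      simp [abs_of_nonneg h1, h2, hrp.le]
    · show 0 ≤ φ y0 - (x0 - h); rw [← hx0]; linarith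
  have hlim : ∀ᶠ h in 𝓝[>] (0:ℝ), G₁ (x0 - h, y0) + (σ y0 - τ - b * h + 2 * τ * M * h) < 0 := by
    have hc := C.c1 (φ y0, y0) ⟨hy0, le_refl _⟩
    have h1 : Tendsto (fun h : ℝ => (φ y0 - h, y0)) (𝓝[>] 0)
        (𝓝[{p | p.2 < 0 ∧ p.1 ≤ φ p.2}] (φ y0, y0)) := by
      apply tendsto_nhdsWithin_of_tendsto_nhds_of_eventually_within
      · have : Continuous (fun h : ℝ => (φ y0 - h, y0)) := by fun_prop
        have := this.tendsto 0
        simp only [sub_zero] at this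
        exact this.mono_left nhdsWithin_le_nhds
      · filter_upwards [self_mem_nhdsWithin] with h hh
        have hh : 0 < h := hh
        exact ⟨hy0, by show φ y0 - h ≤ φ y0; linarith⟩
    have h2 := hc.tendsto.comp h1
    have h3 : Tendsto (fun h : ℝ => σ y0 - τ - b * h + 2 * τ * M * h) (𝓝[>] 0)
        (𝓝 (σ y0 - τ - b * 0 + 2 * τ * M * 0)) := by
      have : Continuous (fun h : ℝ => σ y0 - τ - b * h + 2 * τ * M * h) := by fun_prop
      exact (this.tendsto 0).mono_left nhdsWithin_le_nhds
    have h4 := h2.add h3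
    refine h4.eventually_lt_const ?_
    rw [← hx0, hσ0]; linarith
  obtain ⟨h0, hh0, hh1⟩ := (mem_nhdsGT_iff_exists_Ioo_subset).1 hlim
  have hh0 : 0 < h0 := hh0
  set h1 := min h0 r with hh1d
  have h1p : 0 < h1 := lt_min hh0 hrp
  have hanti : StrictAntiOn F (Icc 0 h1) := by
    have hder : ∀ h, 0 < h → HasDerivAt F (G₁ (x0 - h, y0) + (σ y0 - τ - b * h + 2 * τ * M * h)) h := by
      intro h hh
      have d0 := (hasDerivAt_id h).const_sub x0
      have d1 := C.path (X := fun s => x0 - s) (Y := fun _ => y0) (t := h) d0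
        (hasDerivAt_const _ _) hy0 (by rw [← hx0]; linarith)
      have d2 := d0.const_sub (φ y0)
      have d3 := d0.sub_const x0
      have d := ((((d2.const_mul (σ y0 - τ)).sub ((d2.pow 2).const_mul (b / 2))).add
        (d1.const_mul (-1))).add ((((d3.pow 2).const_mul (τ * M)).add_const
          (τ * M * (y0 - y0) ^ 2)).add_const (0 * (y0 - y0))))
      refine d.congr_deriv ?_
      simp [← hx0]; ring
    apply strictAntiOn_of_deriv_neg (convex_Icc _ _)
    · have hu : Continuous (fun h => u (x0 - h) y0) :=
        C.ucont.comp_continuous (f := fun h : ℝ => (x0 - h, y0)) (by fun_prop) (fun _ => hy0)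
      have : Continuous F := by
        have e : F = fun h => ((σ y0 - τ) * (φ y0 - (x0 - h)) - b / 2 * (φ y0 - (x0 - h)) ^ 2 +
          (τ * M * (x0 - h - x0) ^ 2 + τ * M * (y0 - y0) ^ 2 + 0 * (y0 - y0))) -
            u (x0 - h) y0 := by
          funext h; simp only [F, W]; ring
        rw [e]
        exact Continuous.sub (by fun_prop) hu
      exact this.continuousOn
    · intro h hh
      rw [interior_Icc] at hh
      rw [(hder h hh.1).deriv]
      exact hh1 ⟨hh.1, hh.2.trans_le (min_le_left _ _)⟩
  have := hanti ⟨le_refl _, h1p.le⟩ ⟨h1p.le, le_refl _⟩ h1p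
  have := hFge h1 h1p.le (min_le_right _ _)
  linarith

end Cfg

namespace Cfg
variable {k K : ℝ} {u : ℝ → ℝ → ℝ} {φ : ℝ → ℝ} {G₁ G₂ : ℝ × ℝ → ℝ}

set_option maxHeartbeats 1000000 in
theorem u_le (C : Cfg k K u φ G₁ G₂) {y0 κ a η b A : ℝ} (hy0 : y0 < 0) {σ : ℝ → ℝ}
    (hσ : AnalyticAt ℝ σ y0) (hγ0 : 0 < κ * deriv φ y0 - 1)
    (hid : ∀ᶠ y in 𝓝 y0, σ y * (κ * deriv φ y - 1) =
      A + η * (Real.log (1 - y) - Real.log (1 - y0)))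
    (hst : 0 < a * σ y0 + κ * deriv σ y0 - b * (κ * deriv φ y0 - 1))
    (hmin : ∀ᶠ p : ℝ × ℝ in 𝓝 (φ y0, y0), p.1 < φ p.2 → G₁ p + κ * G₂ p ≤
      A + η * (Real.log (1 - p.2) - Real.log (1 - y0)) - a * u p.1 p.2) :
    ∀ᶠ p : ℝ × ℝ in 𝓝 (φ y0, y0), p.1 < φ p.2 →
      u p.1 p.2 ≤ σ p.2 * (φ p.2 - p.1) - b / 2 * (φ p.2 - p.1) ^ 2 := by
  set x0 := φ y0 with hx0
  have hφ := C.phi_at hy0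
  have snd : Tendsto (fun p : ℝ × ℝ => p.2) (𝓝 (x0, y0)) (𝓝 y0) := continuous_snd.tendsto (x0, y0)
  have cc : ∀ {h : ℝ → ℝ}, AnalyticAt ℝ h y0 → ContinuousAt (fun p : ℝ × ℝ => h p.2) (x0, y0) :=
    fun hh => ContinuousAt.comp (f := fun p : ℝ × ℝ => p.2) hh.continuousAt continuousAt_snd
  have c1 := cc hσ
  have c2 := cc hσ.deriv
  have c4 := cc hφ
  have c5 := cc hφ.deriv
  set γ0 := κ * deriv φ y0 - 1 with hγ0d
  let N : ℝ × ℝ → ℝ := fun p => a * σ p.2 - a * b / 2 * (φ p.2 - p.1) + κ * deriv σ p.2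
    - b * (κ * deriv φ p.2 - 1)
  have hN : ∀ᶠ p in 𝓝 (x0, y0), 0 < N p := by
    have : ContinuousAt N (x0, y0) := by simp only [N]; fun_prop
    apply continuousAt_const.eventually_lt this
    simp only [N, ← hx0]; linarith
  have hγ : ∀ᶠ p : ℝ × ℝ in 𝓝 (x0, y0), γ0 / 2 < κ * deriv φ p.2 - 1 := by
    have : ContinuousAt (fun p : ℝ × ℝ => κ * deriv φ p.2 - 1) (x0, y0) := by fun_prop
    apply continuousAt_const.eventually_lt this
    simp only; linarith
  obtain ⟨r, hrp, hball⟩ := Metric.eventually_nhds_iff.1 (hN.and (hγ.and ((snd.eventually hid).and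
    (hmin.and ((snd.eventually hσ.eventually_analyticAt).and
      (snd.eventually (Iio_mem_nhds hy0)))))))
  have hT1 : ∀ᶠ p : ℝ × ℝ in 𝓝 (x0, y0),
      2 * (φ p.2 - p.1) / γ0 * (1 + |κ|) < r / 2 := by
    have : ContinuousAt (fun p : ℝ × ℝ => 2 * (φ p.2 - p.1) / γ0 * (1 + |κ|)) (x0, y0) := by
      fun_prop
    apply this.eventually_lt continuousAt_const
    simp only [← hx0, sub_self]; simp; exact hrp
  filter_upwards [hT1, Metric.ball_mem_nhds ((x0, y0) : ℝ × ℝ) (half_pos hrp)] with p hp1 hp2 hpG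
  set g := φ p.2 - p.1 with hg
  have hgp : 0 < g := by rw [hg]; linarith
  set T1 := 2 * g / γ0 with hT1d
  have hT1p : 0 < T1 := by positivity
  have hP : ∀ t ∈ Icc 0 T1, dist (p.1 - t, p.2 - κ * t) ((x0, y0) : ℝ × ℝ) < r := by
    intro s hs
    have h1 : dist (p.1 - s, p.2 - κ * s) p ≤ T1 * (1 + |κ|) := by
      rw [Prod.dist_eq, max_le_iff]
      simp only [Real.dist_eq]
      have e1 : |p.1 - s - p.1| = s := by rw [sub_sub_cancel_left, abs_neg, abs_of_nonneg hs.1]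
      have e2 : |p.2 - κ * s - p.2| = |κ| * s := by
        rw [sub_sub_cancel_left, abs_neg, abs_mul, abs_of_nonneg hs.1]
      rw [e1, e2]
      have h1 := abs_nonneg κ
      have h2 := hs.2
      have h3 := mul_le_mul_of_nonneg_left h2 h1
      have h4 := mul_nonneg hT1p.le h1
      constructor <;> linarith
    have h2 := dist_triangle (p.1 - s, p.2 - κ * s) p ((x0, y0) : ℝ × ℝ)
    have h3 := Metric.mem_ball.1 hp2
    linarith
  -- the G function along the path
  let m : ℝ → ℝ := fun t => φ (p.2 - κ * t) - (p.1 - t)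
  have hY : ∀ t, HasDerivAt (fun t => p.2 - κ * t) (-κ) t := fun t =>
    (((hasDerivAt_id t).const_mul κ).const_sub p.2).congr_deriv (by simp)
  have hX : ∀ t, HasDerivAt (fun t => p.1 - t) (-1) t := fun t =>
    ((hasDerivAt_id t).const_sub p.1)
  have hφY : ∀ t ∈ Icc 0 T1, HasDerivAt (fun t => φ (p.2 - κ * t))
      (deriv φ (p.2 - κ * t) * (-κ)) t := fun t ht =>
    (C.phi_d (hball (hP t ht)).2.2.2.2.2).comp t (hY t)
  have hm' : ∀ t ∈ Icc 0 T1, HasDerivAt m (-(κ * deriv φ (p.2 - κ * t) - 1)) t := fun t ht =>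
    ((hφY t ht).sub (hX t)).congr_deriv (by ring)
  have hmc : ContinuousOn m (Icc 0 T1) := fun t ht => (hm' t ht).continuousAt.continuousWithinAt
  have hms : StrictAntiOn m (Icc 0 T1) := by
    apply strictAntiOn_of_deriv_neg (convex_Icc _ _) hmc
    intro t ht
    have ht := interior_subset ht
    rw [(hm' t ht).deriv]
    have := (hball (hP t ht)).2.1
    simp only at this
    linarith
  have hm0 : m 0 = g := by simp [m, hg]
  have hmT1 : m T1 ≤ 0 := by
    obtain ⟨s, hs, hse⟩ := exists_hasDerivAt_eq_slope m _ hT1p hmc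
      (fun s hs => hm' s ⟨hs.1.le, hs.2.le⟩)
    have := (hball (hP s ⟨hs.1.le, hs.2.le⟩)).2.1
    simp only at this
    rw [eq_div_iff (by linarith), hm0, sub_zero] at hse
    have h3 : γ0 / 2 * T1 = g := by rw [hT1d]; field_simp
    have h4 := mul_lt_mul_of_pos_right this hT1p
    linarith
  obtain ⟨T, hT, hmT⟩ := intermediate_value_Icc' hT1p.le hmc (show (0:ℝ) ∈ Icc (m T1) (m 0) from
    ⟨hmT1, by rw [hm0]; exact hgp.le⟩)
  have hpos : ∀ t ∈ Ico 0 T, 0 < m t := by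
    intro t ht
    rw [← hmT]
    exact hms ⟨ht.1, ht.2.le.trans hT.2⟩ hT ht.2
  let E : ℝ → ℝ := fun t => Real.exp (-a * t) * (u (p.1 - t) (p.2 - κ * t) -
    (σ (p.2 - κ * t) * m t - b / 2 * m t ^ 2))
  have hsub : ∀ t ∈ Icc 0 T, t ∈ Icc 0 T1 := fun t ht => ⟨ht.1, ht.2.trans hT.2⟩
  have hσY : ∀ t ∈ Icc 0 T1, HasDerivAt (fun t => σ (p.2 - κ * t))
      (deriv σ (p.2 - κ * t) * (-κ)) t := fun t ht => by
    have := (hball (hP t ht)).2.2.2.2.1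
    exact (this.differentiableAt.hasDerivAt).comp t (hY t)
  have hEc : ContinuousOn E (Icc 0 T) := by
    intro t ht
    have ht1 := hsub t ht
    have k1 : ContinuousAt (fun t => u (p.1 - t) (p.2 - κ * t)) t :=
      ContinuousAt.comp (f := fun t : ℝ => (p.1 - t, p.2 - κ * t)) (g := fun q : ℝ × ℝ => u q.1 q.2)
        (C.ucontAt (hball (hP t ht1)).2.2.2.2.2) (by fun_prop)
    have k2 := (hm' t ht1).continuousAt
    have k3 := (hσY t ht1).continuousAt
    have k4 : ContinuousAt (fun t => Real.exp (-a * t)) t := by fun_prop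
    exact (k4.mul (k1.sub ((k3.mul k2).sub (continuousAt_const.mul (k2.pow 2))))).continuousWithinAt
  have hE : MonotoneOn E (Icc 0 T) := by
    apply monotoneOn_of_deriv_nonneg (convex_Icc _ _) hEc
    · intro t ht
      rw [interior_Icc] at ht
      have ht1 := hsub t ⟨ht.1.le, ht.2.le⟩
      have hp := hpos t ⟨ht.1.le, ht.2⟩
      have hy := (hball (hP t ht1)).2.2.2.2.2
      have d1 := C.path (hX t) (hY t) hy (by simp only [m] at hp; linarith)
      have k2 := hm' t ht1
      have k3 := hσY t ht1
      have k4 : HasDerivAt (fun t => Real.exp (-a * t)) (Real.exp (-a * t) * (-a * 1)) t :=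
        ((hasDerivAt_id t).const_mul (-a)).exp
      exact (k4.mul (d1.sub ((k3.mul k2).sub
        ((k2.pow 2).const_mul (b / 2))))).differentiableAt.differentiableWithinAt
    · intro t ht
      rw [interior_Icc] at ht
      have ht1 := hsub t ⟨ht.1.le, ht.2.le⟩
      have hp := hpos t ⟨ht.1.le, ht.2⟩
      obtain ⟨q1, q2, q3, q4, -, hy⟩ := hball (hP t ht1)
      have hx : p.1 - t < φ (p.2 - κ * t) := by simp only [m] at hp; linarith
      have d1 := C.path (hX t) (hY t) hy hx
      have k2 := hm' t ht1
      have k3 := hσY t ht1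
      have k4 : HasDerivAt (fun t => Real.exp (-a * t)) (Real.exp (-a * t) * (-a * 1)) t :=
        ((hasDerivAt_id t).const_mul (-a)).exp
      have d := k4.mul (d1.sub ((k3.mul k2).sub ((k2.pow 2).const_mul (b / 2))))
      have e : deriv E t = _ := d.deriv
      rw [e]
      have q4 := q4 hx
      simp only at q1 q2 q3 q4
      have hmt : φ (p.2 - κ * t) - (p.1 - t) = m t := rfl
      have hNt := mul_pos hp q1
      simp only [N, hmt] at hNt
      set ex := Real.exp (-a * t)
      have hex : 0 < ex := Real.exp_pos _
      have hgoal : 0 ≤ ex * ((-(G₁ (p.1 - t, p.2 - κ * t) + κ * G₂ (p.1 - t, p.2 - κ * t))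
          + κ * deriv σ (p.2 - κ * t) * m t
          + σ (p.2 - κ * t) * (κ * deriv φ (p.2 - κ * t) - 1)
          - b * m t * (κ * deriv φ (p.2 - κ * t) - 1))
          - a * (u (p.1 - t) (p.2 - κ * t) - (σ (p.2 - κ * t) * m t - b / 2 * m t ^ 2))) := by
        apply mul_nonneg hex.le
        linarith
      refine hgoal.trans_eq ?_
      simp
      ring
  have hfin := hE ⟨le_refl _, hT.1⟩ ⟨hT.1, le_refl _⟩ hT.1
  have hT0 : E T = 0 := by
    have hy := (hball (hP T hT)).2.2.2.2.2
    have hxT : p.1 - T = φ (p.2 - κ * T) := by simp only [m] at hmT; linarith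
    simp only [E, hmT]
    rw [hxT, C.zero hy]; ring
  have hE0 : E 0 = u p.1 p.2 - (σ p.2 * g - b / 2 * g ^ 2) := by
    simp only [E, hm0]; simp
  linarith

set_option maxHeartbeats 1000000 in
theorem no_bdry (C : Cfg k K u φ G₁ G₂) {y0 κ ε η : ℝ} (hy0 : y0 < 0) (hκ : κ = ε ∨ κ = -ε)
    (hε : 0 < ε) (hε1 : ε ≤ 1) (hη : 0 < η) (hηε : η ≤ ε / 16) (hεk : ε * (1 + k) < 1 / 8)
    (hneg : -G₁ (φ y0, y0) - κ * G₂ (φ y0, y0) < 0)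
    (hmin : ∀ᶠ p : ℝ × ℝ in 𝓝 (φ y0, y0), p.1 ≤ φ p.2 →
      -G₁ (φ y0, y0) - κ * G₂ (φ y0, y0) - ε / 4 * u (φ y0) y0 + η * Real.log (1 - y0) ≤
        -G₁ p - κ * G₂ p - ε / 4 * u p.1 p.2 + η * Real.log (1 - p.2)) : False := by
  have hk := C.kpos
  have hφ := C.phi_at hy0
  rw [C.zero hy0] at hmin
  set f := deriv φ y0 with hf
  set f2 := deriv (deriv φ) y0 with hf2
  have hf2d : HasDerivAt (deriv φ) f2 y0 := hφ.deriv.differentiableAt.hasDerivAt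
  set q := √(1 + f ^ 2) with hq
  have hqp : 0 < q := Real.sqrt_pos.2 (by positivity)
  have hq2 : q ^ 2 = 1 + f ^ 2 := Real.sq_sqrt (by positivity)
  have g1e : G₁ (φ y0, y0) = - q⁻¹ := C.G1_eq hy0
  have g2e : G₂ (φ y0, y0) = f * q⁻¹ := C.G2_eq hy0
  set γ0 := κ * f - 1 with hγ
  have hγ0 : 0 < γ0 := by
    rw [g1e, g2e] at hneg
    have : 0 < q⁻¹ * γ0 := by rw [hγ]; linarith
    exact (mul_pos_iff_of_pos_left (inv_pos.2 hqp)).1 this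
  set g1 := -(1 - y0)⁻¹ with hg1
  have h1y : 0 < 1 - y0 := by linarith
  have hg1a : |g1| ≤ 1 := by
    rw [hg1, abs_neg, abs_of_pos (inv_pos.2 h1y)]
    exact inv_le_one_of_one_le₀ (by linarith)
  have hlogd : HasDerivAt (fun y : ℝ => Real.log (1 - y)) g1 y0 := by
    have h := ((hasDerivAt_id y0).const_sub 1).log (by simp; linarith)
    exact h.congr_deriv (by simp [hg1]; ring)
  -- first order condition
  have hfirst : (κ + f) * f2 = η * g1 * q ^ 3 := by
    have hloc : IsLocalMin (fun y => (1 - κ * deriv φ y) * (√(1 + deriv φ y ^ 2))⁻¹ +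
        η * Real.log (1 - y)) y0 := by
      have ct : Tendsto (fun y => (φ y, y)) (𝓝 y0) (𝓝 (φ y0, y0)) :=
        hφ.continuousAt.prodMk continuousAt_id
      filter_upwards [ct.eventually hmin, Iio_mem_nhds hy0] with y h1 hy
      have h1 := h1 le_rfl
      rw [C.zero hy, C.G1_eq hy, C.G2_eq hy, g1e, g2e] at h1
      show (1 - κ * f) * q⁻¹ + η * Real.log (1 - y0) ≤ _
      linarith
    have ds : HasDerivAt (fun y => √(1 + deriv φ y ^ 2)) (2 * f * f2 / (2 * q)) y0 := by
      have := ((hf2d.pow 2).const_add 1).sqrt (show 1 + deriv φ y0 ^ 2 ≠ 0 by positivity)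
      exact this.congr_deriv (by simp [← hf, hq])
    have d := ((((hf2d.const_mul κ).const_sub 1).mul (ds.inv hqp.ne')).add (hlogd.const_mul η))
    have hz := hloc.hasDerivAt_eq_zero d
    simp only [← hf, ← hq, Pi.inv_apply] at hz
    field_simp at hz
    rw [hq2] at hz
    linarith
  set σ1 := -(f * f2) / q ^ 3 with hσ1
  obtain ⟨b, hb1, hb2⟩ := room hqp hq2 hγ hγ0 hκ hε hε1 hη hηε hg1a hfirst hk hεk hσ1
  set A := q⁻¹ * γ0 with hA
  let σ : ℝ → ℝ := fun y => (A + η * (Real.log (1 - y) - Real.log (1 - y0))) / (κ * deriv φ y - 1)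
  have hσa : AnalyticAt ℝ σ y0 := by
    have l1 : AnalyticAt ℝ (fun y : ℝ => Real.log (1 - y)) y0 :=
      (analyticAt_const.sub analyticAt_id).log h1y
    exact (analyticAt_const.add (analyticAt_const.mul (l1.sub analyticAt_const))).div
      ((analyticAt_const.mul hφ.deriv).sub analyticAt_const) hγ0.ne'
  have hσ0 : σ y0 = q⁻¹ := by
    simp only [σ, ← hf, ← hγ, sub_self, mul_zero, add_zero, hA]; field_simp
  have hσd : deriv σ y0 = σ1 := by
    have d := (((hlogd.sub_const (Real.log (1 - y0))).const_mul η).const_add A).div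
      ((hf2d.const_mul κ).sub_const 1) (by rw [← hf, ← hγ]; exact hγ0.ne')
    have e : deriv σ y0 = _ := d.deriv
    rw [e]
    simp only [← hf, ← hγ, sub_self, mul_zero, add_zero, hA]
    have hηg : η * g1 = (κ + f) * f2 / q ^ 3 := by rw [hfirst]; field_simp
    rw [hηg, hσ1]
    have hκf : κ * f = γ0 + 1 := by rw [hγ]; ring
    have e3 : κ * q ^ 2 = κ + (γ0 + 1) * f := by rw [hq2, ← hκf]; ring
    have e4 : q⁻¹ * γ0 * (κ * f2) = (κ * q ^ 2) * γ0 * f2 / q ^ 3 := by field_simp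
    rw [e4, e3]
    field_simp
    ring
  refine C.hopf hy0 hσa (b := b) (by rw [g1e, hσ0]) ?_ ?_
  · rw [hσ0, hσd, ← hf, ← hf2]
    rw [hq2] at hb1
    have : q⁻¹ * f2 = f2 / q := by ring
    have : k * q⁻¹ = k / q := by ring
    linarith
  · apply C.u_le (κ := κ) (a := ε / 4) (η := η) (A := A) hy0 hσa hγ0
    · have : ∀ᶠ y in 𝓝 y0, κ * deriv φ y - 1 ≠ 0 := by
        have hc : ContinuousAt (fun y => κ * deriv φ y - 1) y0 :=
          (hf2d.continuousAt.const_mul κ).sub continuousAt_const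
        exact hc.eventually_ne hγ0.ne'
      filter_upwards [this] with y hy
      simp only [σ]; field_simp
    · rw [hσ0, hσd, ← hf, ← hγ]
      have : ε / 4 * q⁻¹ = ε / 4 / q := by ring
      linarith
    · filter_upwards [hmin] with p hp hpx
      have := hp hpx.le
      rw [g1e, g2e] at this
      have e : A = κ * (f * q⁻¹) - q⁻¹ := by rw [hA, hγ]; ring
      linarith

end Cfg

namespace Cfg
variable {k K : ℝ} {u : ℝ → ℝ → ℝ} {φ : ℝ → ℝ} {G₁ G₂ : ℝ × ℝ → ℝ}

set_option maxHeartbeats 1000000 in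
theorem claim (C : Cfg k K u φ G₁ G₂) {y1 : ℝ} (hy1 : y1 < 0) :
    ∃ ε, 0 < ε ∧ ∀ κ, (κ = ε ∨ κ = -ε) → ∀ y < y1,
      -(ε / 2) ≤ -G₁ (φ y, y) - κ * G₂ (φ y, y) := by
  have hk := C.kpos
  obtain ⟨M, hM⟩ := C.grad_left hy1
  have hMφ : ∀ y ≤ y1, M < φ y := fun y hy => (hM M le_rfl y hy).1
  have hGneg : ∀ x y, y < 0 → x ≤ φ y → G₁ (x, y) < 0 := by
    intro x y hy hx
    rcases hx.lt_or_eq with h | h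
    · exact C.gneg x y hy h
    · rw [h, C.G1_eq hy, neg_lt_zero]
      exact inv_pos.2 (Real.sqrt_pos.2 (by positivity))
  obtain ⟨xs, hxs, hxm⟩ := (isCompact_Icc (a := M) (b := φ y1)).exists_isMinOn
    ⟨M, le_rfl, (hMφ y1 le_rfl).le⟩ (f := fun x => -G₁ (x, y1)) (by
      apply ContinuousOn.neg
      exact C.c1.comp (f := fun x : ℝ => (x, y1)) (by fun_prop) (fun x hx => ⟨hy1, hx.2⟩))
  set c1 := -G₁ (xs, y1) with hc1
  have hc1p : 0 < c1 := by have := hGneg xs y1 hy1 hxs.2; rw [hc1]; linarith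
  set K' := max K 1 with hK'
  have hK'p : 0 < K' := lt_of_lt_of_le one_pos (le_max_right _ _)
  have hG2 : ∀ x y, y < 0 → x ≤ φ y → |G₂ (x, y)| ≤ K' := by
    intro x y hy hx
    rcases hx.lt_or_eq with h | h
    · exact (C.bnd x y hy h).trans (le_max_left _ _)
    · rw [h]
      refine le_trans ?_ (le_max_right _ _)
      have := C.gG y hy
      rw [← sq_le_one_iff_abs_le_one]
      nlinarith [sq_nonneg (G₁ (φ y, y))]
  set ε := min 1 (min (c1 / K') (1 / (16 * (1 + k)))) with hε
  have hεp : 0 < ε := lt_min one_pos (lt_min (by positivity) (by positivity))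
  have hε1 : ε ≤ 1 := min_le_left _ _
  have hεK : ε * K' ≤ c1 := by
    have : ε ≤ c1 / K' := (min_le_right _ _).trans (min_le_left _ _)
    rwa [le_div_iff₀ hK'p] at this
  have hεk : ε * (1 + k) < 1 / 8 := by
    have : ε ≤ 1 / (16 * (1 + k)) := (min_le_right _ _).trans (min_le_right _ _)
    rw [le_div_iff₀ (by positivity)] at this
    linarith
  refine ⟨ε, hεp, fun κ hκ yq hyq => ?_⟩
  by_contra hcon
  push Not at hcon
  have hκa : |κ| = ε := by rcases hκ with h | h <;> rw [h] <;> simp [abs_of_pos hεp]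
  set V : ℝ × ℝ → ℝ := fun p => -G₁ p - κ * G₂ p with hV
  set Vq := -G₁ (φ yq, yq) - κ * G₂ (φ yq, yq) with hVq
  have hlog : ∀ y < 0, 0 ≤ Real.log (1 - y) := fun y hy => Real.log_nonneg (by linarith)
  have hlq := hlog yq (by linarith)
  set η := min (ε / 16) ((-(ε / 2) - Vq) / (2 * (Real.log (1 - yq) + 1))) with hη
  have hηp : 0 < η := lt_min (by positivity) (div_pos (by linarith) (by positivity))
  have hηε : η ≤ ε / 16 := min_le_left _ _
  have hηq : η * (2 * (Real.log (1 - yq) + 1)) ≤ -(ε / 2) - Vq := by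
    have := min_le_right (ε / 16) ((-(ε / 2) - Vq) / (2 * (Real.log (1 - yq) + 1)))
    rw [← hη, le_div_iff₀ (by positivity)] at this
    exact this
  set Z : ℝ × ℝ → ℝ := fun p => -G₁ p - κ * G₂ p - ε / 4 * u p.1 p.2 + η * Real.log (1 - p.2) with hZ
  have hZq : Z (φ yq, yq) < -(ε / 2) := by
    simp only [hZ]
    rw [C.zero (by linarith), ← hVq]
    have := mul_nonneg hηp.le hlq
    linarith
  have hκG : ∀ x y, ∀ B, |G₂ (x, y)| ≤ B → κ * G₂ (x, y) ≤ ε * B := by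
    intro x y B hB
    calc κ * G₂ (x, y) ≤ |κ * G₂ (x, y)| := le_abs_self _
      _ = ε * |G₂ (x, y)| := by rw [abs_mul, hκa]
      _ ≤ ε * B := by gcongr
  have huε : ∀ x y, y < 0 → ε / 4 * u x y ≤ ε / 4 := fun x y hy => by
    have := C.u1 x y hy
    nlinarith
  have hZM : ∀ x y, x ≤ M → y ≤ y1 → -(ε / 2) ≤ Z (x, y) := by
    intro x y hx hy
    obtain ⟨h1, h2⟩ := hM x hx y hy
    have h3 := hGneg x y (by linarith) h1.le
    have h4 := hκG x y _ h2
    have h5 := huε x y (by linarith)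
    have h6 := mul_nonneg hηp.le (hlog y (by linarith))
    simp only [hZ]
    linarith
  set N := min (1 - Real.exp (ε * K' / η)) yq with hN
  have hZN : ∀ x y, y ≤ N → x ≤ φ y → -(ε / 2) ≤ Z (x, y) := by
    intro x y hy hx
    have hy2 : y ≤ 1 - Real.exp (ε * K' / η) := hy.trans (min_le_left _ _)
    have hy3 : y ≤ yq := hy.trans (min_le_right _ _)
    have hy0 : y < 0 := by linarith
    have h3 := hGneg x y hy0 hx
    have h4 := hκG x y _ (hG2 x y hy0 hx)
    have h5 := huε x y hy0
    have h6 : ε * K' / η ≤ Real.log (1 - y) := by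
      rw [Real.le_log_iff_exp_le (by linarith)]; linarith
    rw [div_le_iff₀ hηp] at h6
    simp only [hZ]
    linarith
  have hNq : N ≤ yq := min_le_right _ _
  -- compact set
  have hφc : ContinuousOn φ (Icc N y1) := C.phi_cont.mono fun y hy => lt_of_le_of_lt hy.2 hy1
  obtain ⟨B, hB⟩ := isCompact_Icc.bddAbove_image hφc
  set R : Set (ℝ × ℝ) := Icc M B ×ˢ Icc N y1 with hR
  have hRc : IsCompact R := isCompact_Icc.prod isCompact_Icc
  set S : Set (ℝ × ℝ) := R ∩ {p | 0 ≤ φ p.2 - p.1} with hS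
  have hSc : IsCompact S := by
    apply hRc.of_isClosed_subset _ inter_subset_left
    have : ContinuousOn (fun p : ℝ × ℝ => φ p.2 - p.1) R :=
      (hφc.comp continuousOn_snd (fun p hp => hp.2)).sub continuousOn_fst
    exact this.preimage_isClosed_of_isClosed hRc.isClosed isClosed_Ici
  have hSin : ∀ p ∈ S, p.2 < 0 ∧ p.1 ≤ φ p.2 := by
    rintro p ⟨⟨_, h2⟩, h3⟩
    have h3 : 0 ≤ φ p.2 - p.1 := h3
    exact ⟨by linarith [h2.2], by linarith⟩
  have hZc : ContinuousOn Z S := by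
    have k1 := C.c1.mono hSin
    have k2 := C.c2.mono hSin
    have k3 := C.ucont.mono (fun p hp => (hSin p hp).1 : S ⊆ _)
    have k4 : ContinuousOn (fun p : ℝ × ℝ => Real.log (1 - p.2)) S := by
      apply ContinuousOn.log (by fun_prop)
      intro p hp
      have := (hSin p hp).1
      linarith
    exact ((k1.neg.sub (continuousOn_const.mul k2)).sub (continuousOn_const.mul k3)).add
      (continuousOn_const.mul k4)
  have hSmem : ∀ x y, M ≤ x → x ≤ φ y → N ≤ y → y ≤ y1 → (x, y) ∈ S := by
    intro x y h1 h2 h3 h4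
    refine ⟨⟨⟨h1, h2.trans (hB (mem_image_of_mem _ ⟨h3, h4⟩))⟩, h3, h4⟩, ?_⟩
    show 0 ≤ φ y - x
    linarith
  have hqS := hSmem (φ yq) yq (hMφ yq hyq.le).le le_rfl hNq hyq.le
  obtain ⟨p0, hp0S, hp0m⟩ := hSc.exists_isMinOn ⟨_, hqS⟩ hZc
  obtain ⟨x0, y0⟩ := p0
  have hZ0 : Z (x0, y0) < -(ε / 2) := lt_of_le_of_lt (hp0m hqS) hZq
  have hglob : ∀ x y, y ≤ y1 → x ≤ φ y → Z (x0, y0) ≤ Z (x, y) := by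
    intro x y hy hx
    by_cases h1 : x ≤ M
    · exact hZ0.le.trans (hZM x y h1 hy)
    by_cases h2 : y ≤ N
    · exact hZ0.le.trans (hZN x y h2 hx)
    push Not at h1 h2
    exact hp0m (hSmem x y h1.le hx h2.le hy)
  obtain ⟨hy0, hx0⟩ : y0 < 0 ∧ x0 ≤ φ y0 := hSin _ hp0S
  have hy01 : y0 < y1 := by
    refine lt_of_le_of_ne hp0S.1.2.2 fun h => ?_
    rw [show y0 = y1 from h] at hZ0 hx0
    have h3 : c1 ≤ -G₁ (x0, y1) := hxm (show x0 ∈ Icc M (φ y1) from ⟨hp0S.1.1.1, hx0⟩)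
    have h4 := hκG x0 y1 _ (hG2 x0 y1 hy1 hx0)
    have h5 := huε x0 y1 hy1
    have h6 := mul_nonneg hηp.le (hlog y1 hy1)
    simp only [hZ] at hZ0
    linarith
  have hev : ∀ᶠ p : ℝ × ℝ in 𝓝 (x0, y0), p.2 < y1 :=
    (continuousAt_snd (p := ((x0, y0) : ℝ × ℝ))).eventually_lt continuousAt_const hy01
  rcases hx0.lt_or_eq with h | h
  · refine C.no_int (κ := κ) (a := ε / 4) hηp hy0 h ?_
    filter_upwards [hev, C.isOpen_om.mem_nhds (show (x0, y0) ∈ {p : ℝ × ℝ | p.2 < 0 ∧ p.1 < φ p.2}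
      from ⟨hy0, h⟩)] with p h1 h2
    exact hglob p.1 p.2 h1.le h2.2.le
  · subst h
    refine C.no_bdry hy0 hκ hεp hε1 hηp hηε hεk ?_ ?_
    · have h6 := mul_nonneg hηp.le (hlog y0 hy0)
      simp only [hZ] at hZ0
      rw [C.zero hy0] at hZ0
      linarith
    · filter_upwards [hev] with p h1 h2
      exact hglob p.1 p.2 h1.le h2

theorem deriv_bd (C : Cfg k K u φ G₁ G₂) {y1 : ℝ} (hy1 : y1 < 0) :
    ∃ B : NNReal, ∀ y < y1, |deriv φ y| ≤ B := by
  obtain ⟨ε, hε, h⟩ := C.claim hy1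
  refine ⟨⟨2 / ε + 1, by positivity⟩, fun y hy => ?_⟩
  show _ ≤ 2 / ε + 1
  have hy0 : y < 0 := by linarith
  have key : ∀ κ, (κ = ε ∨ κ = -ε) → κ * deriv φ y ≤ 1 + ε / 2 * (1 + |deriv φ y|) := by
    intro κ hκ
    have h1 := h κ hκ y hy
    rw [C.G1_eq hy0, C.G2_eq hy0] at h1
    set f := deriv φ y
    set q := √(1 + f ^ 2) with hq
    have hqp : 0 < q := Real.sqrt_pos.2 (by positivity)
    have hq1 : q ≤ 1 + |f| := by
      rw [hq, Real.sqrt_le_left (by positivity)]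
      nlinarith [sq_abs f, abs_nonneg f]
    have h2 := mul_le_mul_of_nonneg_right h1 hqp.le
    have h3 : (- -q⁻¹ - κ * (f * q⁻¹)) * q = 1 - κ * f := by field_simp
    rw [h3] at h2
    have h4 := mul_le_mul_of_nonneg_left hq1 hε.le
    linarith
  have h5 : ε * |deriv φ y| ≤ 1 + ε / 2 * (1 + |deriv φ y|) := by
    rcases abs_cases (deriv φ y) with ⟨e, _⟩ | ⟨e, _⟩
    · have := key ε (Or.inl rfl); rw [e] at this ⊢; exact this
    · have := key (-ε) (Or.inr rfl); rw [e] at this ⊢; linarith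
  rw [div_add' _ _ _ hε.ne', le_div_iff₀ hε]
  linarith

theorem lip (C : Cfg k K u φ G₁ G₂) {y0 : ℝ} (hy0 : y0 < 0) :
    ∃ B : NNReal, LipschitzOnWith B φ (Iic y0) := by
  obtain ⟨B, hB⟩ := C.deriv_bd (y1 := y0 / 2) (by linarith)
  refine ⟨B, (convex_Iic y0).lipschitzOnWith_of_nnnorm_deriv_le ?_ ?_⟩
  · intro y hy
    have hy : y ≤ y0 := hy
    exact (C.phi_at (by linarith)).differentiableAt
  · intro y hy
    have hy : y ≤ y0 := hy
    have := hB y (by linarith)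
    rw [← NNReal.coe_le_coe, coe_nnnorm, Real.norm_eq_abs]
    exact this

end Cfg

/-- Proposition 4.1: the free boundary graph is globally Lipschitz
away from the road. For a travelling wave `(c,u)` of the one-species problem with
`u` globally Lipschitz, `∂ₓu < 0` on `Ω`, and free boundary the locally Lipschitz
analytic graph `Γ = {(φ(y),y) : y < 0}` with `(0,0) ∈ closure Γ`: for every `y₀ < 0`
the function `φ` is Lipschitz on `(-∞, y₀]`. -/
theorem free_boundary_globally_Lipschitz
    (d D μ c : ℝ) (hd : 0 < d) (hD : 0 < D) (hμ : 0 < μ)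
    (u : ℝ → ℝ → ℝ) (hu : OneSpeciesTW d D μ c u)
    (hLip : ∃ K : NNReal, LipschitzOnWith K (fun p : ℝ × ℝ => u p.1 p.2) lowerH)
    (hmono : ∀ p ∈ posSet u, pdx u p.1 p.2 < 0)
    (φ : ℝ → ℝ)
    (hφa : AnalyticOnNhd ℝ φ (Iio 0))
    (hφl : ∀ y < (0:ℝ), ∃ ε > 0, ∃ K : NNReal, LipschitzOnWith K φ (Metric.ball y ε))
    (hΓ : freeBdry u = {p : ℝ × ℝ | ∃ y < (0:ℝ), p = (φ y, y)})
    (h0 : ((0:ℝ), (0:ℝ)) ∈ closure (freeBdry u)) :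
    ∀ y₀ < (0:ℝ), ∃ K : NNReal, LipschitzOnWith K φ (Iic y₀) := by
  intro y₀ hy₀
  obtain ⟨k, K, G₁, G₂, C⟩ := mk_cfg d D μ c hd u hu hLip hmono φ hφa hΓ
  exact C.lip hy₀
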